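/- arXiv:2010.13079 — 2 statements merged into one kernel-verified Lean document; each statement's English description precedes it below -/
import Mathlib

section
/- Let q = p^e be a power of a prime with q ≡ 1 (mod 6), t = (q-1)/6, ω₆ = ω^t, ω₃ = ω^{2t}, ω₂ = ω^{3t}, and let λ ∈ 𝔽_q with λ ≠ 0 and λ⁶ ≠ 1. For the equivalence class of w = (0,0,0,0,1,5): Σ_{w'∈[0,0,0,0,1,5]} N_q(0,w') + S_{[0,0,0,0,1,5]} = q³·ω₆(-1)·₃F₂(ω₃,ω₂,ω̄₃; ε,ε | 1/λ⁶)_q. -/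
open scoped Classical

noncomputable section

/-- The Gauss sum `g(χ) = ∑ₓ χ(x) exp(2π√-1 · tr(x)/p)` of a multiplicative character `χ`
of a finite field `F` of characteristic `p`, where `tr : F → 𝔽_p` is the trace map. -/
def gaussChar (p : ℕ) (F : Type) [Field F] [Fintype F] [Algebra (ZMod p) F]
    (χ : MulChar F ℂ) : ℂ :=
  ∑ x : F, χ x *
    Complex.exp (2 * Real.pi * Complex.I * ((Algebra.trace (ZMod p) F x).val : ℂ) / (p : ℂ))

/-- The Jacobi sum `J(χ₁, …, χₙ) = ∑_{x₁ + ⋯ + xₙ = 1} χ₁(x₁) ⋯ χₙ(xₙ)`. -/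
def jacobiS (F : Type) [Field F] [Fintype F] {n : ℕ} (χ : Fin n → MulChar F ℂ) : ℂ :=
  ∑ v ∈ Finset.univ.filter (fun v : Fin n → F => ∑ i, v i = 1), ∏ i, χ i (v i)

/-- The normalized Jacobi sum `binom(A; B) = (B(-1)/q) · J(A, B̄)`. -/
def gBinom (F : Type) [Field F] [Fintype F] (A B : MulChar F ℂ) : ℂ :=
  B (-1) / (Fintype.card F : ℂ) * jacobiS F ![A, B⁻¹]

/-- Greene's finite-field hypergeometric function `ₙ₊₁Fₙ` (case `n ≥ 2`), where the sum over all
multiplicative characters is written as a sum over the powers `ω^j`, `0 ≤ j ≤ q - 2`, of a fixed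
generator `ω` of the character group. -/
def greeneF (F : Type) [Field F] [Fintype F] (ω : MulChar F ℂ) {n : ℕ}
    (A : Fin (n + 1) → MulChar F ℂ) (B : Fin n → MulChar F ℂ) (x : F) : ℂ :=
  (Fintype.card F : ℂ) / ((Fintype.card F : ℂ) - 1) *
    ∑ j ∈ Finset.range (Fintype.card F - 1),
      gBinom F (A 0 * ω ^ j) (ω ^ j) *
        (∏ i : Fin n, gBinom F (A i.succ * ω ^ j) (B i * ω ^ j)) * (ω ^ j) x

/-- Greene's finite-field hypergeometric function `₂F₁` (case `n = 1`):
`₂F₁(A₀, A₁; B₁ | x) = ε(x) · (A₁B₁(-1)/q) · ∑_y A₁(y) (A̅₁B₁)(1-y) A̅₀(1-xy)`. -/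
def greene2F1 (F : Type) [Field F] [Fintype F] (A₀ A₁ B₁ : MulChar F ℂ) (x : F) : ℂ :=
  (1 : MulChar F ℂ) x * ((A₁ * B₁) (-1) / (Fintype.card F : ℂ)) *
    ∑ y : F, A₁ y * (A₁⁻¹ * B₁) (1 - y) * A₀⁻¹ (1 - x * y)

/-- The number of `F`-rational points of the Dwork hypersurface
`x₁^d + ⋯ + x_d^d = dλ x₁ ⋯ x_d` in projective space. -/
def dworkCount (F : Type) [Field F] [Fintype F] (d : ℕ) (lam : F) : ℕ :=
  Nat.card {P : Projectivization F (Fin d → F) //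
    ∑ i, P.rep i ^ d = (d : F) * lam * ∏ i, P.rep i}

/-- The number of `F`-rational points of the diagonal hypersurface
`x₁^d + ⋯ + xₙ^d = dλ x₁^{h₁} ⋯ xₙ^{hₙ}` in projective space. -/
def diagCount (F : Type) [Field F] [Fintype F] (d n : ℕ) (h : Fin n → ℕ) (lam : F) : ℕ :=
  Nat.card {P : Projectivization F (Fin n → F) //
    ∑ i, P.rep i ^ d = (d : F) * lam * ∏ i, P.rep i ^ h i}

/-- The quantity `N_q(0, w)` from Koblitz's formula, with `t = (q - 1)/d`. -/
def NqW (p : ℕ) (F : Type) [Field F] [Fintype F] [Algebra (ZMod p) F]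
    (ω : MulChar F ℂ) (d : ℕ) {n : ℕ} (w : Fin n → ZMod d) : ℂ :=
  if ∀ i, w i = 0 then ((Fintype.card F : ℂ) ^ (n - 1) - 1) / ((Fintype.card F : ℂ) - 1)
  else if ∀ i, w i ≠ 0 then
    (1 / (Fintype.card F : ℂ)) *
      ∏ i, gaussChar p F (ω ^ ((w i).val * ((Fintype.card F - 1) / d)))
  else 0

/-- The quantity `S_{[w]} = (q-1)⁻¹ ∑_{j=0}^{q-2} (∏ᵢ g(ω^{wᵢt + hᵢj}) / g(ω^{dj})) ω^{dj}(dλ)`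
from Koblitz's formula, with `t = (q - 1)/d`. -/
def SW (p : ℕ) (F : Type) [Field F] [Fintype F] [Algebra (ZMod p) F]
    (ω : MulChar F ℂ) (d : ℕ) {n : ℕ} (h : Fin n → ℕ) (w : Fin n → ZMod d) (lam : F) : ℂ :=
  ((Fintype.card F : ℂ) - 1)⁻¹ *
    ∑ j ∈ Finset.range (Fintype.card F - 1),
      (∏ i, gaussChar p F (ω ^ ((w i).val * ((Fintype.card F - 1) / d) + h i * j))) /
          gaussChar p F (ω ^ (d * j)) * (ω ^ (d * j)) ((d : F) * lam)

end


namespace HD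
set_option linter.unusedSectionVars false
open Finset

section field
variable {F : Type} [Field F] [Fintype F]

/-- Cubic residue sum over the fibre of `x(1-x)`. -/
noncomputable def Dsum (ρ : MulChar F ℂ) (a : F) : ℂ :=
  ∑ x ∈ univ.filter (fun x : F => x * (1 - x) = a), ρ (x * (1 - x) ^ 2)

/-- Fibre count of `w³/(3w-1)`. -/
noncomputable def Ncount (a : F) : ℕ :=
  (univ.filter (fun w : F => w ^ 3 / (3 * w - 1) = a)).card

lemma root_of_mem {a w : F} (ha : a ≠ 0) (h : w ^ 3 / (3 * w - 1) = a) :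
    w ^ 3 - 3 * a * w + a = 0 := by
  have h3 : 3 * w - 1 ≠ 0 := by
    intro h0; rw [h0, div_zero] at h; exact ha h.symm
  rw [div_eq_iff h3] at h
  linear_combination h

lemma quad_fibre {x y a : F} (hx : x * (1 - x) = a) (hy : y * (1 - y) = a) :
    y = x ∨ y = 1 - x := by
  have : (y - x) * (y - (1 - x)) = 0 := by linear_combination hx - hy
  rcases mul_eq_zero.1 this with h | h
  · left; linear_combination h
  · right; linear_combination h

lemma N_le_three {a : F} (ha : a ≠ 0) : Ncount a ≤ 3 := by
  classical
  unfold Ncount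
  let P : Polynomial F := Polynomial.X ^ 3 - Polynomial.C (3 * a) * Polynomial.X + Polynomial.C a
  have hdeg : P.natDegree = 3 := by
    simp only [P]; compute_degree!
  have hP : P ≠ 0 := by intro h; rw [h] at hdeg; simp at hdeg
  calc _ ≤ P.roots.toFinset.card := by
        apply card_le_card
        intro w hw
        rw [mem_filter] at hw
        have := root_of_mem ha hw.2
        rw [Multiset.mem_toFinset, Polynomial.mem_roots hP]
        simp [P, Polynomial.IsRoot, this]
    _ ≤ Multiset.card P.roots := Multiset.toFinset_card_le _
    _ ≤ 3 := hdeg ▸ P.card_roots'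

lemma disc_rel {a w : F} (h : w ^ 3 - 3 * a * w + a = 0) :
    (w ^ 2 - 4 * a) * (w ^ 2 - a) ^ 2 = a ^ 2 * (1 - 4 * a) := by
  linear_combination (w ^ 3 - 3 * a * w - a) * h

lemma sqrt_neg_three {ρ : MulChar F ℂ} (hρ : ρ ^ 3 = 1) (hρ1 : ρ ≠ 1) :
    ∃ s : F, s ^ 2 = -3 := by
  have hc : ∃ z : F, z ≠ 1 ∧ z ^ 3 = 1 := by
    by_contra hcon
    push Not at hcon
    apply hρ1
    ext u
    have inj : Function.Injective (fun v : Fˣ => v ^ 3) := by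
      intro v v' hv
      simp only at hv
      by_contra hne
      apply hcon ((v / v' : Fˣ) : F)
      · intro h
        apply hne
        have : v / v' = 1 := Units.ext h
        exact div_eq_one.1 this
      · have : (v / v') ^ 3 = 1 := by rw [div_pow, hv, div_self']
        rw [← Units.val_pow_eq_pow_val, this, Units.val_one]
    obtain ⟨v, hv⟩ := Finite.surjective_of_injective inj u
    rw [← hv]
    simp only [Units.val_pow_eq_pow_val, map_pow]
    have := congrArg (fun χ : MulChar F ℂ => χ (v : F)) hρ
    simp only [MulChar.pow_apply_coe] at this
    rw [this]; simp
  obtain ⟨z, hz1, hz⟩ := hc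
  have : z ^ 2 + z + 1 = 0 := by
    have : (z - 1) * (z ^ 2 + z + 1) = 0 := by linear_combination hz
    exact (mul_eq_zero.1 this).resolve_left (sub_ne_zero.2 hz1)
  exact ⟨2 * z + 1, by linear_combination 4 * this⟩

lemma rho_cube {ρ : MulChar F ℂ} (hρ : ρ ^ 3 = 1) {x : F} (hx : x ≠ 0) : ρ x ^ 3 = 1 := by
  have := congrArg (fun χ : MulChar F ℂ => χ x) hρ
  simpa [MulChar.pow_apply' _ (show (3:ℕ) ≠ 0 by norm_num), MulChar.one_apply (isUnit_iff_ne_zero.2 hx)] using this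

lemma D_bound (h2 : (2 : F) ≠ 0) (h3 : (3 : F) ≠ 0) {ρ : MulChar F ℂ} (hρ : ρ ^ 3 = 1) (hρ1 : ρ ≠ 1)
    {a : F} (ha : a ≠ 0) :
    ∃ r : ℤ, Dsum ρ a = r ∧ (Ncount a : ℤ) - 1 ≤ r := by
  classical
  by_cases hx : ∃ x : F, x * (1 - x) = a
  · obtain ⟨x, hx⟩ := hx
    have hx0 : x ≠ 0 := by rintro rfl; apply ha; rw [← hx]; ring
    have hx1 : 1 - x ≠ 0 := by intro h; apply ha; rw [← hx, h]; ring
    have hfil : univ.filter (fun y : F => y * (1 - y) = a) = {x, 1 - x} := by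
      ext y
      simp only [mem_filter, mem_univ, true_and, mem_insert, mem_singleton]
      constructor
      · intro hy; exact quad_fibre hx hy
      · rintro (rfl | rfl)
        · exact hx
        · rw [← hx]; ring
    by_cases hd : x = 1 - x
    · -- double root
      have hxe : 2 * x = 1 := by linear_combination hd
      refine ⟨1, ?_, ?_⟩
      · unfold Dsum
        have : univ.filter (fun y : F => y * (1 - y) = a) = {x} := by
          rw [hfil, ← hd]; simp
        rw [show (filter (fun y : F => y * (1 - y) = a) univ) = {x} by convert this]
        rw [sum_singleton, ← hd, show x * x ^ 2 = x ^ 3 by ring, map_pow, rho_cube hρ hx0]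
        simp
      · have h4 : 4 * a = 1 := by rw [← hx]; linear_combination (1 - 2 * x) * hxe
        have : Ncount a ≤ 2 := by
          unfold Ncount
          calc _ ≤ ({-1, x} : Finset F).card := by
                apply card_le_card
                intro w hw
                rw [mem_filter] at hw
                have hr := root_of_mem ha hw.2
                have : (w + 1) * (w - x) ^ 2 = 0 := by
                  have h16 : (4:F) ≠ 0 := by
                    rw [show (4:F) = 2 * 2 by norm_num]; exact mul_ne_zero h2 h2
                  apply mul_left_cancel₀ h16
                  rw [mul_zero]
                  linear_combination 4 * hr + (3 * w - 1) * h4 + ((w + 1) * (2 * x + 1 - 4 * w)) * hxe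
                rcases mul_eq_zero.1 this with h | h
                · simp [eq_neg_of_add_eq_zero_left h]
                · simp [sub_eq_zero.1 (pow_eq_zero_iff (two_ne_zero) |>.1 h)]
            _ ≤ 2 := card_le_two
        lia
    · have hD : Dsum ρ a = ρ (x * (1 - x) ^ 2) + ρ (x * (1 - x) ^ 2) ^ 2 := by
        unfold Dsum
        rw [show (filter (fun y : F => y * (1 - y) = a) univ) = {x, 1 - x} by convert hfil]
        rw [sum_pair hd]
        congr 1
        rw [← map_pow, show (x * (1 - x) ^ 2) ^ 2 = ((1 - x) * (1 - (1 - x)) ^ 2) * (1 - x) ^ 3 by ring,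
          map_mul ρ _ ((1 - x) ^ 3), map_pow ρ (1 - x) 3, rho_cube hρ hx1, mul_one]
      have hc3 := rho_cube hρ (mul_ne_zero hx0 (pow_ne_zero 2 hx1))
      by_cases hc : ρ (x * (1 - x) ^ 2) = 1
      · refine ⟨2, ?_, ?_⟩
        · rw [hD, hc]; norm_num
        · have := N_le_three ha; lia
      · refine ⟨-1, ?_, ?_⟩
        · rw [hD]
          have : (ρ (x * (1 - x) ^ 2) - 1) * (ρ (x * (1 - x) ^ 2) + ρ (x * (1 - x) ^ 2) ^ 2 + 1) = 0 := by
            linear_combination hc3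
          have := (mul_eq_zero.1 this).resolve_left (sub_ne_zero.2 hc)
          push_cast
          linear_combination this
        · suffices Ncount a = 0 by simp [this]
          unfold Ncount
          rw [card_eq_zero, filter_eq_empty_iff]
          intro w _ hw
          have hr := root_of_mem ha hw
          have hdr := disc_rel hr
          have h14 : 1 - 4 * a = (2 * x - 1) ^ 2 := by rw [← hx]; ring
          have hwa : w ^ 2 - a ≠ 0 := by
            intro h
            rw [h] at hdr
            have : a ^ 2 * (2 * x - 1) ^ 2 = 0 := by rw [← h14, ← hdr]; ring
            rw [← mul_pow, pow_eq_zero_iff two_ne_zero] at this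
            have := (mul_eq_zero.1 this).resolve_left ha
            exact hd (by linear_combination this)
          -- the root of the resolvent
          set s := a * (2 * x - 1) / (w ^ 2 - a) with hs
          have hs2 : s ^ 2 = w ^ 2 - 4 * a := by
            rw [hs, div_pow, div_eq_iff (pow_ne_zero 2 hwa), hdr, h14]; ring
          have hs1 : s * (w ^ 2 - a) = a * (2 * x - 1) := by rw [hs]; field_simp
          have hm : ((w + s) / 2) ^ 3 = -(a * (1 - x)) := by
            have h8 : (8:F) ≠ 0 := by
              rw [show (8:F) = 2 ^ 3 by norm_num]; exact pow_ne_zero 3 h2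
            have : (w + s) ^ 3 = -(a * (1 - x)) * 8 := by
              linear_combination 4 * hr + 4 * hs1 + (3 * w + s) * hs2
            rw [div_pow, this]; field_simp; norm_num
          apply hc
          have e : x * (1 - x) ^ 2 = (-((w + s) / 2)) ^ 3 := by
            rw [Odd.neg_pow (by decide), hm, ← hx]; ring
          have hne : -((w + s) / 2) ≠ 0 := by
            intro h
            rw [h] at e
            exact mul_ne_zero hx0 (pow_ne_zero 2 hx1) (by rw [e]; ring)
          rw [e, map_pow, rho_cube hρ hne]
  · refine ⟨0, ?_, ?_⟩
    · unfold Dsum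
      rw [sum_eq_zero]; simp
      intro x hx'
      exact absurd ⟨x, (mem_filter.1 hx').2⟩ hx
    · suffices Ncount a ≤ 1 by lia
      unfold Ncount
      rw [card_le_one]
      intro w hw w' hw'
      by_contra hne
      have hr := root_of_mem ha (mem_filter.1 hw).2
      have hr' := root_of_mem ha (mem_filter.1 hw').2
      have hq : w' ^ 2 + w * w' + w ^ 2 - 3 * a = 0 := by
        have : (w' - w) * (w' ^ 2 + w * w' + w ^ 2 - 3 * a) = 0 := by linear_combination hr' - hr
        exact (mul_eq_zero.1 this).resolve_left (sub_ne_zero.2 (Ne.symm hne))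
      obtain ⟨s, hs⟩ := sqrt_neg_three hρ hρ1
      have hdr := disc_rel hr
      have hs0 : s ≠ 0 := by
        rintro rfl; apply h3; linear_combination hs
      -- v = square root of `1 - 4a`
      set v := (2 * w' + w) / s * (w ^ 2 - a) / a with hv
      have hv2 : v ^ 2 = 1 - 4 * a := by
        have e1 : (2 * w' + w) ^ 2 = s ^ 2 * (w ^ 2 - 4 * a) := by
          rw [hs]; linear_combination 4 * hq
        rw [hv, div_pow, mul_pow, div_pow, e1, div_eq_iff (pow_ne_zero 2 ha), mul_div_cancel_left₀ _ (pow_ne_zero 2 hs0), hdr]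
        ring
      apply hx
      refine ⟨(1 + v) / 2, ?_⟩
      have h16 : (4:F) ≠ 0 := by
        rw [show (4:F) = 2 * 2 by norm_num]; exact mul_ne_zero h2 h2
      field_simp
      linear_combination -hv2

lemma rho_neg_one {ρ : MulChar F ℂ} (hρ : ρ ^ 3 = 1) : ρ (-1) = 1 := by
  have h := rho_cube hρ (x := (-1 : F)) (by simp)
  rw [← map_pow] at h
  rw [← h]; norm_num

lemma sum_D {ρ : MulChar F ℂ} (hρ : ρ ^ 3 = 1) (hρ1 : ρ ≠ 1) :
    ∑ a ∈ univ.filter (fun a : F => a ≠ 0), Dsum ρ a = -1 := by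
  classical
  have hinv : ρ⁻¹ = ρ ^ 2 := by
    rw [inv_eq_iff_mul_eq_one, ← hρ]; group
  have hJ := jacobiSum_nontrivial_inv hρ1
  rw [rho_neg_one hρ, hinv] at hJ
  rw [← hJ, jacobiSum]
  have h0 : Dsum ρ 0 = 0 := by
    unfold Dsum
    apply sum_eq_zero
    intro x hx
    have := (mem_filter.1 hx).2
    rw [show x * (1 - x) ^ 2 = x * (1 - x) * (1 - x) by ring, this, zero_mul, MulChar.map_zero]
  rw [sum_filter_of_ne (by rintro a - h rfl; exact h h0)]
  unfold Dsum
  refine (sum_fiberwise (s := univ) (g := fun x : F => x * (1 - x))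
    (f := fun x => ρ (x * (1 - x) ^ 2))).trans ?_
  apply sum_congr rfl
  intro x _
  rw [map_mul, MulChar.pow_apply' _ two_ne_zero, map_pow]

lemma sum_N (h3 : (3 : F) ≠ 0) :
    ∑ a ∈ univ.filter (fun a : F => a ≠ 0), (Ncount a : ℤ) = (Fintype.card F : ℤ) - 2 := by
  classical
  have h := Finset.card_eq_sum_card_fiberwise (f := fun w : F => w ^ 3 / (3 * w - 1))
    (s := univ.filter (fun w : F => w ^ 3 / (3 * w - 1) ≠ 0)) (t := univ.filter (fun a : F => a ≠ 0))
    (by intro w hw; simpa using hw)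
  have e : ∀ a ∈ univ.filter (fun a : F => a ≠ 0), Ncount a =
      (filter (fun w : F => w ^ 3 / (3 * w - 1) = a) (univ.filter (fun w : F => w ^ 3 / (3 * w - 1) ≠ 0))).card := by
    intro a ha
    unfold Ncount
    congr 1
    ext w
    simp only [mem_filter, mem_univ, true_and] at ha ⊢
    constructor
    · intro h; exact ⟨h ▸ ha, h⟩
    · exact fun h => h.2
  rw [← Nat.cast_sum, sum_congr rfl e, ← h]
  have : univ.filter (fun w : F => w ^ 3 / (3 * w - 1) ≠ 0) = univ \ {0, 3⁻¹} := by
    ext w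
    simp only [mem_filter, mem_univ, true_and, mem_sdiff, mem_insert, mem_singleton, not_or, ne_eq,
      div_eq_zero_iff, pow_eq_zero_iff (three_ne_zero)]
    have : 3 * w - 1 = 0 ↔ w = 3⁻¹ := by
      constructor
      · intro h; field_simp; linear_combination h
      · rintro rfl; field_simp; ring
    rw [this]
  rw [show (filter (fun w : F => w ^ 3 / (3 * w - 1) ≠ 0) univ) = univ \ {0, 3⁻¹} by convert this]
  rw [card_sdiff_of_subset (subset_univ _), card_pair (inv_ne_zero h3).symm, card_univ]
  have : 2 ≤ Fintype.card F := Fintype.one_lt_card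
  omega

lemma D_eq (h2 : (2 : F) ≠ 0) (h3 : (3 : F) ≠ 0) {ρ : MulChar F ℂ} (hρ : ρ ^ 3 = 1) (hρ1 : ρ ≠ 1)
    {a : F} (ha : a ≠ 0) : Dsum ρ a = (Ncount a : ℂ) - 1 := by
  classical
  choose! r hr hle using fun a (ha : a ≠ 0) => D_bound h2 h3 hρ hρ1 (a := a) ha
  have hsum : ∑ a ∈ univ.filter (fun a : F => a ≠ 0), ((Ncount a : ℤ) - 1) =
      ∑ a ∈ univ.filter (fun a : F => a ≠ 0), r a := by
    have hR : ∑ a ∈ univ.filter (fun a : F => a ≠ 0), r a = -1 := by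
      have := sum_D hρ hρ1
      rw [sum_congr rfl (fun a ha => hr a (mem_filter.1 ha).2)] at this
      exact_mod_cast this
    have hcard : (univ.filter (fun a : F => a ≠ 0)).card = Fintype.card F - 1 := by
      rw [filter_ne' univ 0, card_erase_of_mem (mem_univ _), card_univ]
    rw [hR, sum_sub_distrib, sum_N h3, sum_const, nsmul_one]
    rw [show (#(filter (fun a : F => a ≠ 0) univ)) = Fintype.card F - 1 by convert hcard]
    have : 2 ≤ Fintype.card F := Fintype.one_lt_card
    push_cast [Nat.cast_sub (show 1 ≤ Fintype.card F by omega)]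
    ring
  have := (sum_eq_sum_iff_of_le (fun a ha => hle a (mem_filter.1 ha).2)).1 hsum a (by simpa using ha)
  rw [hr a ha, ← this]; push_cast; ring

lemma jacobi_cubic (h2 : (2 : F) ≠ 0) (h3 : (3 : F) ≠ 0) {ρ : MulChar F ℂ} (hρ : ρ ^ 3 = 1)
    (hρ1 : ρ ≠ 1) {χ : MulChar F ℂ} (hχ : χ ≠ 1) :
    jacobiSum (χ * ρ) (χ * ρ ^ 2) * χ 27 = jacobiSum (χ⁻¹ ^ 2) χ⁻¹ := by
  classical
  have e1 : jacobiSum (χ * ρ) (χ * ρ ^ 2) = ∑ a : F, χ a * Dsum ρ a := by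
    unfold Dsum jacobiSum
    simp_rw [mul_sum]
    rw [← sum_fiberwise (s := univ) (g := fun x : F => x * (1 - x))]
    apply sum_congr rfl
    intro a _
    apply sum_congr rfl
    intro x hx
    rw [← (mem_filter.1 hx).2]
    simp only [MulChar.mul_apply, MulChar.pow_apply' _ two_ne_zero, map_mul, map_pow]
    ring
  have e2 : ∑ a : F, χ a * Dsum ρ a = ∑ a : F, χ a * Ncount a := by
    have : ∑ a : F, χ a * Dsum ρ a = ∑ a : F, (χ a * Ncount a - χ a) := by
      apply sum_congr rfl
      intro a _
      by_cases ha : a = 0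
      · rw [ha, MulChar.map_zero]; simp
      · rw [D_eq h2 h3 hρ hρ1 ha]; ring
    rw [this, sum_sub_distrib, MulChar.sum_eq_zero_of_ne_one hχ, sub_zero]
  have e3 : ∑ a : F, χ a * Ncount a = ∑ w : F, χ (w ^ 3 / (3 * w - 1)) := by
    unfold Ncount
    refine Eq.trans ?_ (sum_fiberwise (s := univ) (g := fun w : F => w ^ 3 / (3 * w - 1))
      (f := fun w => χ (w ^ 3 / (3 * w - 1))))
    apply sum_congr rfl
    intro a _
    rw [card_eq_sum_ones, Nat.cast_sum, mul_sum]
    apply sum_congr rfl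
    intro w hw
    rw [(mem_filter.1 hw).2]; simp
  rw [e1, e2, e3, sum_mul, jacobiSum]
  have inv3 : ∀ w : F, 3⁻¹ * (3 * w) = w := fun w => by field_simp
  apply sum_nbij' (fun w => (3 * w)⁻¹) (fun y => 3⁻¹ * y⁻¹)
  · simp
  · simp
  · intro w _; simp [h3]
  · intro w _; simp [h3]
  · intro w _
    by_cases hw : w = 0
    · simp [hw, MulChar.map_zero]
    have h3w : 3 * w ≠ 0 := mul_ne_zero h3 hw
    simp only [MulChar.pow_apply' _ two_ne_zero, MulChar.inv_apply', ← map_mul, ← map_pow]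
    congr 1
    by_cases h31 : 3 * w - 1 = 0
    · rw [h31, show 3 * w = 1 by linear_combination h31]; simp
    · have : 1 - (3 * w)⁻¹ = (3 * w - 1) / (3 * w) := by field_simp
      rw [this]
      field_simp
      norm_num

/-! Gauss sum relations -/

variable {ψ : AddChar F ℂ}

lemma card_ne : (Fintype.card F : ℂ) ≠ 0 := Nat.cast_ne_zero.2 Fintype.card_ne_zero

lemma G_inv (hψ : ψ.IsPrimitive) {χ : MulChar F ℂ} (hχ : χ ≠ 1) :
    gaussSum χ ψ * gaussSum χ⁻¹ ψ = χ (-1) * Fintype.card F := by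
  rw [← gaussSum_mul_gaussSum_eq_card hχ hψ, ← mul_gaussSum_inv_eq_gaussSum χ⁻¹ ψ,
    MulChar.inv_apply']
  rw [show ((-1 : F)⁻¹) = -1 by norm_num]
  ring

lemma psi_ne (hψ : ψ.IsPrimitive) : ψ ≠ 1 := by
  have := hψ (a := 1) one_ne_zero
  simpa using this

lemma G_one (hψ : ψ.IsPrimitive) : gaussSum (1 : MulChar F ℂ) ψ = -1 :=
  gaussSum_one_left (psi_ne hψ)

lemma G_ne (hψ : ψ.IsPrimitive) (χ : MulChar F ℂ) : gaussSum χ ψ ≠ 0 := by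
  by_cases h : χ = 1
  · rw [h, G_one hψ]; norm_num
  · exact gaussSum_ne_zero_of_nontrivial card_ne h hψ

lemma neg_one_sq (χ : MulChar F ℂ) : χ (-1) * χ (-1) = 1 := by
  rw [← map_mul]; simp

lemma one_app {x : F} (hx : x ≠ 0) : (1 : MulChar F ℂ) x = 1 :=
  MulChar.one_apply (isUnit_iff_ne_zero.2 hx)

lemma phi_sq {φ : MulChar F ℂ} (hφ : φ ^ 2 = 1) {x : F} (hx : x ≠ 0) : φ x * φ x = 1 := by
  rw [← MulChar.mul_apply, ← pow_two, hφ, one_app hx]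

/-- A character of order two takes the value `-1` exactly off the squares. -/
lemma phi_count (h2 : (2 : F) ≠ 0) {φ : MulChar F ℂ} (hφ : φ ^ 2 = 1) (hφ1 : φ ≠ 1) {b : F}
    (hb : b ≠ 0) (hns : ¬ IsSquare b) : φ b = -1 := by
  have h := phi_sq hφ hb
  have : (φ b - 1) * (φ b + 1) = 0 := by linear_combination h
  rcases mul_eq_zero.1 this with h1 | h1
  · exfalso
    apply hφ1
    ext u
    rw [one_app u.ne_zero]
    have hodd : ringChar F ≠ 2 := by
      intro hc
      apply h2
      have := ringChar.Nat.cast_ringChar (R := F)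
      rw [hc] at this
      exact_mod_cast this
    by_cases hu : IsSquare (u : F)
    · obtain ⟨v, hv⟩ := hu
      have hv0 : v ≠ 0 := by rintro rfl; apply u.ne_zero; rw [hv]; ring
      rw [hv, map_mul, phi_sq hφ hv0]
    · have hsq : IsSquare ((u : F) * b) := by
        classical
        have e1 := (quadraticChar_neg_one_iff_not_isSquare (F := F)).2 hu
        have e2 := (quadraticChar_neg_one_iff_not_isSquare (F := F)).2 hns
        rw [← quadraticChar_one_iff_isSquare (mul_ne_zero u.ne_zero hb), map_mul, e1, e2]
        norm_num
      obtain ⟨v, hv⟩ := hsq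
      have hv0 : v ≠ 0 := by rintro rfl; apply mul_ne_zero u.ne_zero hb; rw [hv]; ring
      have h3 := phi_sq hφ hv0
      rw [← map_mul, ← hv, map_mul, sub_eq_zero.1 h1, mul_one] at h3
      exact h3
  · linear_combination h1

lemma quad_count (h2 : (2 : F) ≠ 0) {φ : MulChar F ℂ} (hφ : φ ^ 2 = 1) (hφ1 : φ ≠ 1) (a : F) :
    ((univ.filter (fun x : F => x * (1 - x) = a)).card : ℂ) = 1 + φ (1 - 4 * a) := by
  classical
  by_cases hx : ∃ x : F, x * (1 - x) = a
  · obtain ⟨x, hx⟩ := hx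
    have hfil : univ.filter (fun y : F => y * (1 - y) = a) = {x, 1 - x} := by
      ext y
      simp only [mem_filter, mem_univ, true_and, mem_insert, mem_singleton]
      constructor
      · intro hy; exact quad_fibre hx hy
      · rintro (rfl | rfl)
        · exact hx
        · rw [← hx]; ring
    rw [show (filter (fun y : F => y * (1 - y) = a) univ) = {x, 1 - x} by convert hfil]
    have h14 : 1 - 4 * a = (2 * x - 1) * (2 * x - 1) := by rw [← hx]; ring
    rw [h14, map_mul]
    by_cases hd : x = 1 - x
    · rw [← hd, show 2 * x - 1 = 0 by linear_combination hd, MulChar.map_zero]; simp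
    · rw [card_pair hd, phi_sq hφ (fun h => hd (by linear_combination h))]; norm_num
  · have h0 : univ.filter (fun y : F => y * (1 - y) = a) = ∅ := by
      rw [filter_eq_empty_iff]; intro x _ h; exact hx ⟨x, h⟩
    rw [show (filter (fun y : F => y * (1 - y) = a) univ) = ∅ by convert h0]
    have hns : ¬ IsSquare (1 - 4 * a) := by
      rintro ⟨v, hv⟩
      apply hx
      refine ⟨(1 + v) / 2, ?_⟩
      have h16 : (4:F) ≠ 0 := by
        rw [show (4:F) = 2 * 2 by norm_num]; exact mul_ne_zero h2 h2
      field_simp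
      linear_combination hv
    rw [phi_count h2 hφ hφ1 (fun h => hns (by rw [h]; exact IsSquare.zero)) hns]
    simp

lemma jacobi_quad (h2 : (2 : F) ≠ 0) {φ : MulChar F ℂ} (hφ : φ ^ 2 = 1) (hφ1 : φ ≠ 1)
    {χ : MulChar F ℂ} (hχ : χ ≠ 1) : jacobiSum χ χ * χ 4 = jacobiSum χ φ := by
  classical
  have h4 : (4:F) ≠ 0 := by
    rw [show (4:F) = 2 * 2 by norm_num]; exact mul_ne_zero h2 h2
  have e1 : jacobiSum χ χ = ∑ a : F, χ a * (1 + φ (1 - 4 * a)) := by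
    simp_rw [← quad_count h2 hφ hφ1]
    unfold jacobiSum
    rw [← sum_fiberwise (s := univ) (g := fun x : F => x * (1 - x))]
    apply sum_congr rfl
    intro a _
    rw [card_eq_sum_ones, Nat.cast_sum, mul_sum]
    apply sum_congr
    · congr
    intro x hx
    rw [← (mem_filter.1 hx).2, ← map_mul]; simp
  rw [e1]
  simp_rw [mul_add, mul_one]
  rw [sum_add_distrib, MulChar.sum_eq_zero_of_ne_one hχ, zero_add, sum_mul, jacobiSum]
  apply sum_nbij' (fun a => 4 * a) (fun y => 4⁻¹ * y)
  · simp
  · simp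
  · intro w _; simp [h4]
  · intro w _; simp [h4]
  · intro a _
    rw [map_mul]; ring

/-- Hasse-Davenport product formula for `2`. -/
lemma HD2 (hψ : ψ.IsPrimitive) (h2 : (2 : F) ≠ 0) {φ : MulChar F ℂ} (hφ : φ ^ 2 = 1) (hφ1 : φ ≠ 1)
    (χ : MulChar F ℂ) :
    gaussSum χ ψ * gaussSum (χ * φ) ψ * χ 4 = gaussSum (χ ^ 2) ψ * gaussSum φ ψ := by
  have h4 : (4:F) ≠ 0 := by
    rw [show (4:F) = 2 * 2 by norm_num]; exact mul_ne_zero h2 h2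
  have hφφ : φ * φ = 1 := by rw [← pow_two, hφ]
  by_cases h1 : χ = 1
  · rw [h1, one_app h4]; simp
  by_cases hχ2 : χ ^ 2 = 1
  · -- then χ = φ
    have hχφ : χ = φ := by
      ext u
      by_cases hu : IsSquare (u : F)
      · obtain ⟨v, hv⟩ := hu
        have hv0 : v ≠ 0 := by rintro rfl; apply u.ne_zero; rw [hv]; ring
        rw [hv, map_mul, map_mul, phi_sq hφ hv0, phi_sq hχ2 hv0]
      · rw [phi_count h2 hφ hφ1 u.ne_zero hu, phi_count h2 hχ2 h1 u.ne_zero hu]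
    rw [hχφ, hφφ, hφ, show (4:F) = 2 * 2 by norm_num, map_mul, phi_sq hφ h2]
    ring
  · have hJ := jacobi_quad h2 hφ hφ1 h1
    have e1 := jacobiSum_mul_nontrivial (χ := χ) (φ := χ) (by rwa [← pow_two]) ψ
    have hχφ : χ * φ ≠ 1 := by
      intro h
      apply hχ2
      have : (χ * φ) ^ 2 = 1 := by rw [h, one_pow]
      rwa [mul_pow, hφ, mul_one] at this
    have e2 := jacobiSum_mul_nontrivial hχφ ψ
    rw [← pow_two χ] at e1
    rw [← hJ] at e2
    apply mul_left_cancel₀ (G_ne hψ χ)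
    linear_combination (-gaussSum (χ * φ) ψ * χ 4) * e1 + gaussSum (χ ^ 2) ψ * e2

lemma phi_three {φ ρ : MulChar F ℂ} (hφ : φ ^ 2 = 1) (h3 : (3 : F) ≠ 0) (hρ : ρ ^ 3 = 1) (hρ1 : ρ ≠ 1) :
    φ 3 = φ (-1) := by
  obtain ⟨s, hs⟩ := sqrt_neg_three hρ hρ1
  have hs0 : s ≠ 0 := by
    rintro rfl; apply h3; linear_combination hs
  have h := phi_sq hφ hs0
  rw [← map_mul, ← pow_two, hs, show (-3 : F) = -1 * 3 by norm_num, map_mul] at h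
  linear_combination φ (-1) * h - φ 3 * neg_one_sq φ

/-- Hasse-Davenport product formula for `3`. -/
lemma HD3 (hψ : ψ.IsPrimitive) (h2 : (2 : F) ≠ 0) (h3 : (3 : F) ≠ 0) {ρ : MulChar F ℂ}
    (hρ : ρ ^ 3 = 1) (hρ1 : ρ ≠ 1) (χ : MulChar F ℂ) :
    gaussSum χ ψ * gaussSum (χ * ρ) ψ * gaussSum (χ * ρ ^ 2) ψ * χ 27 =
      Fintype.card F * gaussSum (χ ^ 3) ψ := by
  have h27 : (27 : F) = 3 ^ 3 := by norm_num
  have hinv : ρ⁻¹ = ρ ^ 2 := by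
    rw [inv_eq_iff_mul_eq_one, ← hρ]; group
  have hρρ : gaussSum ρ ψ * gaussSum (ρ ^ 2) ψ = Fintype.card F := by
    rw [← hinv, G_inv hψ hρ1, rho_neg_one hρ, one_mul]
  by_cases hχ3 : χ ^ 3 = 1
  · rw [hχ3, G_one hψ, h27, map_pow, rho_cube hχ3 h3]
    -- χ is a power of ρ
    by_cases hχ : χ = 1
    · rw [hχ, one_mul, one_mul, G_one hψ]; linear_combination -hρρ
    have key : ∀ χ : MulChar F ℂ, χ ^ 3 = 1 → χ ≠ 1 → χ = ρ ∨ χ = ρ ^ 2 := by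
      intro χ hχ3 hχ
      obtain ⟨g, hg⟩ := IsCyclic.exists_generator (α := Fˣ)
      have ext' : ∀ χ₁ χ₂ : MulChar F ℂ, χ₁ (g : F) = χ₂ (g : F) → χ₁ = χ₂ := by
        intro χ₁ χ₂ h
        ext u
        obtain ⟨n, hn⟩ := (mem_powers_iff_mem_zpowers).2 (hg u)
        simp only at hn
        rw [← hn, Units.val_pow_eq_pow_val, map_pow, map_pow, h]
      have hg0 := g.ne_zero
      have hz : ρ g ≠ 1 := fun h => hρ1 (ext' _ _ (by rw [h, one_app hg0]))
      have hz3 := rho_cube hρ hg0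
      have hz' : ρ (g : F) ^ 2 + ρ (g : F) + 1 = 0 := by
        have : (ρ (g : F) - 1) * (ρ (g : F) ^ 2 + ρ (g : F) + 1) = 0 := by linear_combination hz3
        exact (mul_eq_zero.1 this).resolve_left (sub_ne_zero.2 hz)
      have hy : χ g ≠ 1 := fun h => hχ (ext' _ _ (by rw [h, one_app hg0]))
      have hy3 := rho_cube hχ3 hg0
      have hy' : (χ (g : F) - ρ g) * (χ (g : F) - ρ g ^ 2) = 0 := by
        have : (χ (g : F) - 1) * ((χ (g : F) - ρ g) * (χ (g : F) - ρ g ^ 2)) = 0 := by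
          linear_combination hy3 + (χ (g : F) - χ (g : F) ^ 2) * hz' + (χ (g : F) - 1) * hz3
        exact (mul_eq_zero.1 this).resolve_left (sub_ne_zero.2 hy)
      rcases mul_eq_zero.1 hy' with h | h
      · left; exact ext' _ _ (sub_eq_zero.1 h)
      · right; exact ext' _ _ (by rw [MulChar.pow_apply' _ two_ne_zero]; exact sub_eq_zero.1 h)
    rcases key χ hχ3 hχ with h | h
    · rw [h, ← pow_two, ← pow_succ', hρ, G_one hψ]; linear_combination -hρρ
    · rw [h, ← pow_succ, hρ, G_one hψ, ← pow_add, show 2 + 2 = 3 + 1 by norm_num, pow_add, hρ,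
        one_mul, pow_one]; linear_combination -hρρ
  have hχ : χ ≠ 1 := by rintro rfl; exact hχ3 (one_pow _)
  have hmul : χ * ρ * (χ * ρ ^ 2) = χ ^ 2 := by
    rw [mul_mul_mul_comm, ← pow_succ', hρ, mul_one, pow_two]
  by_cases hχ2 : χ ^ 2 = 1
  · have hχi : χ⁻¹ = χ := by rw [inv_eq_iff_mul_eq_one, ← pow_two, hχ2]
    have hne : χ * ρ ≠ 1 := by
      intro h
      apply hχ3
      have : (χ * ρ) ^ 3 = 1 := by rw [h, one_pow]
      rwa [mul_pow, hρ, mul_one] at this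
    have h := G_inv hψ hne
    rw [mul_inv, hχi, hinv, MulChar.mul_apply, rho_neg_one hρ] at h
    have hχ33 : χ ^ 3 = χ := by rw [pow_succ, hχ2, one_mul]
    rw [h27, map_pow, phi_three hχ2 h3 hρ hρ1, hχ33]
    linear_combination (gaussSum χ ψ * χ (-1) ^ 3) * h + gaussSum χ ψ * Fintype.card F * (χ (-1) ^ 2 + 1) * neg_one_sq χ
  · have hJ := jacobi_cubic h2 h3 hρ hρ1 hχ
    have e1 := jacobiSum_mul_nontrivial (χ := χ * ρ) (φ := χ * ρ ^ 2) (by rwa [hmul]) ψ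
    rw [hmul] at e1
    have h3' : χ⁻¹ ^ 2 * χ⁻¹ = (χ ^ 3)⁻¹ := by rw [← pow_succ, inv_pow]
    have e2 := jacobiSum_mul_nontrivial (χ := χ⁻¹ ^ 2) (φ := χ⁻¹) (by rw [h3']; exact inv_ne_one.2 hχ3) ψ
    rw [h3', inv_pow] at e2
    rw [inv_pow] at hJ
    have i1 := G_inv hψ hχ
    have i2 := G_inv hψ hχ2
    have i3 := G_inv hψ hχ3
    rw [MulChar.pow_apply' _ two_ne_zero] at i2
    rw [MulChar.pow_apply' _ three_ne_zero] at i3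
    apply mul_right_cancel₀ (G_ne hψ (χ ^ 3)⁻¹)
    rw [mul_assoc _ (gaussSum (χ ^ 3) ψ), i3, mul_assoc (gaussSum χ ψ), ← e1]
    have : gaussSum χ ψ * (gaussSum (χ ^ 2) ψ * jacobiSum (χ * ρ) (χ * ρ ^ 2)) * χ 27 * gaussSum (χ ^ 3)⁻¹ ψ
        = (gaussSum χ ψ * gaussSum χ⁻¹ ψ) * (gaussSum (χ ^ 2) ψ * gaussSum (χ ^ 2)⁻¹ ψ) := by
      linear_combination (gaussSum χ ψ * gaussSum (χ ^ 2) ψ * gaussSum (χ ^ 3)⁻¹ ψ) * hJ +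
        gaussSum χ ψ * gaussSum (χ ^ 2) ψ * e2
    rw [this, i1, i2]; ring

lemma HD6 (hψ : ψ.IsPrimitive) (h2 : (2 : F) ≠ 0) (h3 : (3 : F) ≠ 0) {α : MulChar F ℂ}
    (hα : α ^ 6 = 1) (hα2 : α ^ 2 ≠ 1) (hα3 : α ^ 3 ≠ 1) (χ : MulChar F ℂ) :
    gaussSum χ ψ * gaussSum (χ * α) ψ * gaussSum (χ * α ^ 2) ψ * gaussSum (χ * α ^ 3) ψ *
      gaussSum (χ * α ^ 4) ψ * gaussSum (χ * α ^ 5) ψ * (χ ^ 6) 6 =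
      (Fintype.card F : ℂ) ^ 2 * α (-1) * gaussSum (χ ^ 6) ψ * gaussSum (α ^ 3) ψ := by
  have r3 : (α ^ 2) ^ 3 = 1 := by rw [← pow_mul, hα]
  have f2 : (α ^ 3) ^ 2 = 1 := by rw [← pow_mul, hα]
  have a1 := HD3 hψ h2 h3 r3 hα2 χ
  have a2 := HD3 hψ h2 h3 r3 hα2 (χ * α ^ 3)
  have a3 := HD2 hψ h2 f2 hα3 (χ ^ 3)
  have p3 := phi_three f2 h3 r3 hα2
  have c1 : χ * (α ^ 2) ^ 2 = χ * α ^ 4 := by rw [← pow_mul]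
  have c2 : χ * α ^ 3 * α ^ 2 = χ * α ^ 5 := by rw [mul_assoc, ← pow_add]
  have c3 : χ * α ^ 3 * (α ^ 2) ^ 2 = χ * α := by
    rw [mul_assoc, ← pow_mul, ← pow_add, show 3 + 2 * 2 = 6 + 1 by norm_num, pow_add, hα]; simp
  have c4 : (χ * α ^ 3) ^ 3 = χ ^ 3 * α ^ 3 := by
    rw [mul_pow, ← pow_mul, show 3 * 3 = 6 + 3 by norm_num, pow_add, hα, one_mul]
  have c5 : (χ ^ 3) ^ 2 = χ ^ 6 := by rw [← pow_mul]
  rw [c1] at a1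
  rw [c2, c3, c4, MulChar.mul_apply, show (27 : F) = 3 ^ 3 by norm_num, map_pow (α ^ 3), p3,
    MulChar.pow_apply' α three_ne_zero] at a2
  rw [c5, MulChar.pow_apply' χ three_ne_zero] at a3
  rw [MulChar.pow_apply' χ (show 6 ≠ 0 by norm_num)]
  have hx : χ 6 ^ 6 = χ 27 * χ (3 ^ 3) * χ 4 ^ 3 := by
    rw [← map_pow, ← map_pow, ← map_mul, ← map_mul]; norm_num
  have hn := neg_one_sq α
  have hn9 : (α (-1) ^ 3) ^ 3 = α (-1) := by
    have : α (-1) ^ 2 = 1 := by rw [pow_two, hn]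
    calc (α (-1) ^ 3) ^ 3 = (α (-1) ^ 2) ^ 4 * α (-1) := by ring
      _ = _ := by rw [this]; ring
  rw [hn9] at a2
  rw [hx]
  have hmul : (gaussSum χ ψ * gaussSum (χ * α ^ 2) ψ * gaussSum (χ * α ^ 4) ψ * χ 27) *
      (gaussSum (χ * α ^ 3) ψ * gaussSum (χ * α ^ 5) ψ * gaussSum (χ * α) ψ * (χ (3 ^ 3) * α (-1))) *
      χ 4 ^ 3 = (Fintype.card F : ℂ) ^ 2 * (gaussSum (χ ^ 6) ψ * gaussSum (α ^ 3) ψ) := by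
    rw [a1, a2, ← a3]; ring
  linear_combination α (-1) * hmul - (gaussSum χ ψ * gaussSum (χ * α ^ 2) ψ * gaussSum (χ * α ^ 4) ψ * χ 27) *
      (gaussSum (χ * α ^ 3) ψ * gaussSum (χ * α ^ 5) ψ * gaussSum (χ * α) ψ * (χ (3 ^ 3))) *
      χ 4 ^ 3 * hn

/-- Term of `S`. -/
noncomputable def Tm (ψ : AddChar F ℂ) (α : MulChar F ℂ) (lam : F) (χ : MulChar F ℂ) : ℂ :=
  gaussSum χ ψ ^ 4 * gaussSum (χ * α) ψ * gaussSum (χ * α ^ 5) ψ / gaussSum (χ ^ 6) ψ *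
    (χ ^ 6) (6 * lam)

/-- Term of the hypergeometric side. -/
noncomputable def Rm (ψ : AddChar F ℂ) (α : MulChar F ℂ) (lam : F) (χ : MulChar F ℂ) : ℂ :=
  α (-1) * χ (-1) / gaussSum (α ^ 3) ψ * gaussSum χ ψ ^ 3 * gaussSum (χ⁻¹ * α ^ 2) ψ *
    gaussSum (χ⁻¹ * α ^ 3) ψ * gaussSum (χ⁻¹ * α ^ 4) ψ * χ (lam ^ 6)

lemma TR (hψ : ψ.IsPrimitive) (h2 : (2 : F) ≠ 0) (h3 : (3 : F) ≠ 0) {α : MulChar F ℂ}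
    (hα : α ^ 6 = 1) (hα2 : α ^ 2 ≠ 1) (hα3 : α ^ 3 ≠ 1) (lam : F) (χ : MulChar F ℂ) :
    Tm ψ α lam χ * ((gaussSum (χ * α ^ 2) ψ * gaussSum (χ * α ^ 2)⁻¹ ψ) *
      (gaussSum (χ * α ^ 3) ψ * gaussSum (χ * α ^ 3)⁻¹ ψ) *
      (gaussSum (χ * α ^ 4) ψ * gaussSum (χ * α ^ 4)⁻¹ ψ)) =
    (Fintype.card F : ℂ) ^ 3 * α (-1) * χ (-1) * Rm ψ α lam χ := by
  have h := HD6 hψ h2 h3 hα hα2 hα3 χ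
  have i2 : (χ * α ^ 2)⁻¹ = χ⁻¹ * α ^ 4 := by
    rw [mul_inv]; congr 1; rw [inv_eq_iff_mul_eq_one, ← pow_add, hα]
  have i3 : (χ * α ^ 3)⁻¹ = χ⁻¹ * α ^ 3 := by
    rw [mul_inv]; congr 1; rw [inv_eq_iff_mul_eq_one, ← pow_add, hα]
  have i4 : (χ * α ^ 4)⁻¹ = χ⁻¹ * α ^ 2 := by
    rw [mul_inv]; congr 1; rw [inv_eq_iff_mul_eq_one, ← pow_add, hα]
  have a3 : (α ^ 3)⁻¹ = α ^ 3 := by rw [inv_eq_iff_mul_eq_one, ← pow_add, hα]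
  have hsq := G_inv hψ hα3
  rw [a3, MulChar.pow_apply' _ three_ne_zero] at hsq
  rw [i2, i3, i4]
  unfold Tm Rm
  have n6 := G_ne hψ (χ ^ 6)
  have nf := G_ne hψ (α ^ 3)
  have nn := neg_one_sq χ
  have na := neg_one_sq α
  have hl : (χ ^ 6) (6 * lam) = (χ ^ 6) 6 * χ (lam ^ 6) := by
    rw [map_mul, MulChar.pow_apply' χ (show 6 ≠ 0 by norm_num) lam, map_pow]
  rw [hl]
  field_simp
  rw [show (χ ^ 6) 6 = (χ ^ 6) 6 from rfl]
  set X := gaussSum χ ψ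
  set L := χ (lam ^ 6)
  set Y := gaussSum (χ⁻¹ * α ^ 2) ψ * gaussSum (χ⁻¹ * α ^ 3) ψ * gaussSum (χ⁻¹ * α ^ 4) ψ
  set q : ℂ := (Fintype.card F : ℂ)
  set f := gaussSum (α ^ 3) ψ
  set G6 := gaussSum (χ ^ 6) ψ
  have na3 : α (-1) ^ 3 = α (-1) := by linear_combination α (-1) * na
  rw [na3] at hsq
  linear_combination (X ^ 3 * L * Y * f) * h + (X ^ 3 * L * Y * q ^ 2 * α (-1) * G6) * hsq
    - (q ^ 3 * α (-1) ^ 2 * X ^ 3 * Y * L * G6) * nn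

lemma T_gen (hψ : ψ.IsPrimitive) (h2 : (2 : F) ≠ 0) (h3 : (3 : F) ≠ 0) {α : MulChar F ℂ}
    (hα : α ^ 6 = 1) (hα2 : α ^ 2 ≠ 1) (hα3 : α ^ 3 ≠ 1) (lam : F) (χ : MulChar F ℂ)
    (k2 : χ * α ^ 2 ≠ 1) (k3 : χ * α ^ 3 ≠ 1) (k4 : χ * α ^ 4 ≠ 1) :
    Tm ψ α lam χ = Rm ψ α lam χ := by
  have h := TR hψ h2 h3 hα hα2 hα3 lam χ
  rw [G_inv hψ k2, G_inv hψ k3, G_inv hψ k4] at h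
  simp only [MulChar.mul_apply, MulChar.pow_apply' α (show 2 ≠ 0 by norm_num),
    MulChar.pow_apply' α (show 3 ≠ 0 by norm_num), MulChar.pow_apply' α (show 4 ≠ 0 by norm_num)] at h
  have nn := neg_one_sq χ
  have na := neg_one_sq α
  have q0 := card_ne (F := F)
  have c0 : α (-1) ≠ 0 := by intro h; rw [h] at na; simp at na
  have x0 : χ (-1) ≠ 0 := by intro h; rw [h] at nn; simp at nn
  apply mul_left_cancel₀ (mul_ne_zero (mul_ne_zero (pow_ne_zero 3 q0) c0) x0)
  rw [← h]
  have e1 : α (-1) ^ 2 = 1 := by rw [pow_two, na]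
  have e2 : χ (-1) ^ 2 = 1 := by rw [pow_two, nn]
  calc _ = (Fintype.card F : ℂ) ^ 3 * α (-1) * χ (-1) * Tm ψ α lam χ * 1 ^ 4 * 1 := by ring
    _ = (Fintype.card F : ℂ) ^ 3 * α (-1) * χ (-1) * Tm ψ α lam χ * (α (-1) ^ 2) ^ 4 * χ (-1) ^ 2 := by
      rw [e1, e2]
    _ = _ := by ring

/-- The value `N_q` for the class representative shifted by `k`. -/
noncomputable def Nk (ψ : AddChar F ℂ) (α χ : MulChar F ℂ) : ℂ :=
  (1 / (Fintype.card F : ℂ)) * (gaussSum χ ψ ^ 4 * gaussSum (χ * α) ψ * gaussSum (χ * α ^ 5) ψ)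

lemma T_exc (hψ : ψ.IsPrimitive) (h2 : (2 : F) ≠ 0) (h3 : (3 : F) ≠ 0) {α : MulChar F ℂ}
    (hα : α ^ 6 = 1) (hα1 : α ≠ 1) (hα2 : α ^ 2 ≠ 1) (hα3 : α ^ 3 ≠ 1) {lam : F} (hl : lam ≠ 0) (k : ℕ)
    (hk : k = 2 ∨ k = 3 ∨ k = 4) :
    Tm ψ α lam (α ^ k) = Rm ψ α lam (α ^ k) - ((Fintype.card F : ℂ) - 1) * Nk ψ α (α ^ k) := by
  have q0 := card_ne (F := F)
  have hα4 : α ^ 4 ≠ 1 := by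
    intro h; apply hα2
    rw [show 6 = 4 + 2 by norm_num, pow_add, h, one_mul] at hα; exact hα
  have hα5 : α ^ 5 ≠ 1 := by
    intro h; apply hα1
    rw [show 6 = 5 + 1 by norm_num, pow_add, h, one_mul, pow_one] at hα; exact hα
  have h6 : (6 : F) ≠ 0 := by
    rw [show (6:F) = 2 * 3 by norm_num]; exact mul_ne_zero h2 h3
  have hk6 : (α ^ k) ^ 6 = 1 := by rw [← pow_mul, mul_comm, pow_mul, hα, one_pow]
  have hT : Tm ψ α lam (α ^ k) = - (Fintype.card F : ℂ) * Nk ψ α (α ^ k) := by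
    unfold Tm Nk
    rw [hk6, G_one hψ, one_app (mul_ne_zero h6 hl)]
    field_simp
  have na := neg_one_sq α
  have e1 : α (-1) ^ 2 = 1 := by rw [pow_two, na]
  have e3 : α (-1) ^ 3 = α (-1) := by linear_combination α (-1) * e1
  have e4 : α (-1) ^ 4 = 1 := by linear_combination (α (-1) ^ 2 + 1) * e1
  have e5 : α (-1) ^ 5 = α (-1) := by linear_combination α (-1) * e4
  have c0 : α (-1) ≠ 0 := by intro h; rw [h] at na; simp at na
  have h7 : α ^ 7 = α := by rw [show 7 = 6 + 1 by norm_num, pow_add, hα, one_mul, pow_one]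
  have h8 : α ^ 8 = α ^ 2 := by rw [show 8 = 6 + 2 by norm_num, pow_add, hα, one_mul]
  have hTR : Tm ψ α lam (α ^ k) = Fintype.card F * Rm ψ α lam (α ^ k) := by
    have h := TR hψ h2 h3 hα hα2 hα3 lam (α ^ k)
    have p1 : gaussSum (1 : MulChar F ℂ) ψ * gaussSum (1 : MulChar F ℂ)⁻¹ ψ = 1 := by
      rw [inv_one, G_one hψ]; norm_num
    rcases hk with rfl | rfl | rfl <;>
    · simp only [← pow_add, Nat.reduceAdd, hα, h7, h8, p1] at h
      simp only [G_inv hψ hα1, G_inv hψ hα2, G_inv hψ hα4, G_inv hψ hα5,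
        MulChar.pow_apply' α (show 2 ≠ 0 by norm_num),
        MulChar.pow_apply' α (show 3 ≠ 0 by norm_num), MulChar.pow_apply' α (show 4 ≠ 0 by norm_num),
        MulChar.pow_apply' α (show 5 ≠ 0 by norm_num), e1, e3, e4, e5, one_mul, mul_one] at h
      apply mul_left_cancel₀ (mul_ne_zero (pow_ne_zero 2 q0) c0)
      first
        | linear_combination h
        | linear_combination α (-1) * h + (Rm ψ α lam (α ^ 3) * (Fintype.card F : ℂ) ^ 3 * α (-1) - Tm ψ α lam (α ^ 3) * (Fintype.card F : ℂ) ^ 2 * α (-1)) * e1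
  have hR : Rm ψ α lam (α ^ k) = - Nk ψ α (α ^ k) := by
    apply mul_left_cancel₀ q0
    rw [← hTR, hT]; ring
  rw [hT, hR]; ring

lemma jacobiS_eq (χ₁ χ₂ : MulChar F ℂ) : jacobiS F ![χ₁, χ₂] = jacobiSum χ₁ χ₂ := by
  unfold jacobiS jacobiSum
  apply sum_nbij' (fun v => v 0) (fun x => ![x, 1 - x])
  · simp
  · simp
  · intro v hv
    simp only [mem_filter, mem_univ, true_and, Fin.sum_univ_two] at hv
    ext i
    fin_cases i
    · simp
    · simp [← hv]
  · simp
  · intro v hv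
    simp only [mem_filter, mem_univ, true_and, Fin.sum_univ_two] at hv
    simp [← hv]

lemma binom_eq (hψ : ψ.IsPrimitive) {A : MulChar F ℂ} (hA : A ≠ 1) (χ : MulChar F ℂ) :
    gBinom F (A * χ) χ =
      χ (-1) / Fintype.card F * (gaussSum (A * χ) ψ * gaussSum χ⁻¹ ψ / gaussSum A ψ) := by
  unfold gBinom
  rw [jacobiS_eq]
  have h := jacobiSum_eq_gaussSum_mul_gaussSum_div_gaussSum (card_ne (F := F)) (χ := A * χ) (φ := χ⁻¹)
    (by simpa using hA) hψ
  rw [h]; simp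

lemma greene_term (hψ : ψ.IsPrimitive) {α : MulChar F ℂ}
    (hα : α ^ 6 = 1) (hα2 : α ^ 2 ≠ 1) (hα3 : α ^ 3 ≠ 1) (lam : F) (χ : MulChar F ℂ) :
    (Fintype.card F : ℂ) ^ 4 * α (-1) *
      (gBinom F (α ^ 2 * χ) χ * (gBinom F (α ^ 3 * χ) χ * gBinom F ((α ^ 2)⁻¹ * χ) χ) * χ (lam ^ 6)⁻¹) =
      Rm ψ α lam χ⁻¹ := by
  have hρi : (α ^ 2)⁻¹ = α ^ 4 := by rw [inv_eq_iff_mul_eq_one, ← pow_add, hα]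
  have h := G_inv hψ hα2
  have e1 : (α ^ 2) (-1) = 1 := by rw [MulChar.pow_apply' _ two_ne_zero, pow_two, neg_one_sq]
  rw [e1, one_mul] at h
  rw [binom_eq hψ hα2, binom_eq hψ hα3, binom_eq hψ (inv_ne_one.2 hα2)]
  unfold Rm
  rw [inv_inv, MulChar.inv_apply', MulChar.inv_apply', inv_neg_one, mul_comm χ, mul_comm χ, mul_comm χ, ← hρi]
  have q0 := card_ne (F := F)
  have n1 := G_ne hψ (α ^ 2)
  have n2 := G_ne hψ (α ^ 2)⁻¹
  have n3 := G_ne hψ (α ^ 3)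
  have nn := neg_one_sq χ
  generalize χ (lam ^ 6)⁻¹ = L
  have : χ (-1) ^ 3 = χ (-1) := by linear_combination χ (-1) * nn
  field_simp
  linear_combination (Fintype.card F * α (-1) * gaussSum (α ^ 2 * χ) ψ * gaussSum χ⁻¹ ψ ^ 3 *
    gaussSum (α ^ 3 * χ) ψ * gaussSum ((α ^ 2)⁻¹ * χ) ψ * L) * this -
    (α (-1) * χ (-1) * gaussSum (α ^ 2 * χ) ψ * gaussSum χ⁻¹ ψ ^ 3 *
    gaussSum (α ^ 3 * χ) ψ * gaussSum ((α ^ 2)⁻¹ * χ) ψ * L) * h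

end field

/-- The additive character. -/
noncomputable def psi (p : ℕ) [Fact p.Prime] (F : Type) [Field F] [Fintype F] [Algebra (ZMod p) F] :
    AddChar F ℂ :=
  (ZMod.stdAddChar (N := p)).compAddMonoidHom (Algebra.trace (ZMod p) F).toAddMonoidHom

lemma gaussChar_eq (p : ℕ) [Fact p.Prime] (F : Type) [Field F] [Fintype F] [Algebra (ZMod p) F]
    (χ : MulChar F ℂ) : gaussChar p F χ = gaussSum χ (psi p F) := by
  unfold gaussChar gaussSum
  apply sum_congr rfl
  intro x _
  congr 1
  have := ZMod.stdAddChar_coe (N := p) ((Algebra.trace (ZMod p) F x).val : ℤ)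
  rw [Int.cast_natCast, Int.cast_natCast, ZMod.natCast_zmod_val] at this
  simp only [psi, AddChar.compAddMonoidHom_apply]
  exact this.symm

lemma psi_prim (p : ℕ) [Fact p.Prime] (F : Type) [Field F] [Fintype F] [Algebra (ZMod p) F] :
    (psi p F).IsPrimitive := by
  apply AddChar.IsPrimitive.of_ne_one
  intro h
  have : (ZMod.stdAddChar (N := p)) 1 = 1 := by
    obtain ⟨x, hx⟩ := Algebra.trace_surjective (ZMod p) F 1
    have := congrArg (fun f : AddChar F ℂ => f x) h
    simp only [psi, AddChar.compAddMonoidHom_apply, AddChar.one_apply] at this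
    rw [← this]
    congr 1
    exact hx.symm
  have h0 := ZMod.injective_stdAddChar (N := p) (this.trans (AddChar.map_zero_eq_one _).symm)
  exact one_ne_zero h0

lemma order_omega {F : Type} [Field F] [Fintype F] (ω : MulChar F ℂ)
    (hω : ∀ χ : MulChar F ℂ, ∃ j : ℕ, χ = ω ^ j) : orderOf ω = Fintype.card F - 1 := by
  have h1 : orderOf ω = Nat.card (MulChar F ℂ) := by
    apply orderOf_eq_card_of_forall_mem_zpowers
    intro χ
    obtain ⟨j, hj⟩ := hω χ
    exact ⟨j, by simp [hj]⟩
  rw [h1, MulChar.card_eq_card_units_of_hasEnoughRootsOfUnity, Nat.card_units, Nat.card_eq_fintype_card]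

lemma sum_inv {M : Type*} [Group M] (ω : M) {n : ℕ} (hn : 0 < n) (ho : ω ^ n = 1) (f : M → ℂ) :
    ∑ j ∈ range n, f (ω ^ j)⁻¹ = ∑ j ∈ range n, f (ω ^ j) := by
  apply sum_nbij' (fun j => if j = 0 then 0 else n - j) (fun j => if j = 0 then 0 else n - j)
  · intro j hj; simp only [mem_range] at *; split_ifs <;> omega
  · intro j hj; simp only [mem_range] at *; split_ifs <;> omega
  · intro j hj; simp only [mem_range] at *; split_ifs <;> omega
  · intro j hj; simp only [mem_range] at *; split_ifs <;> omega
  · intro j hj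
    simp only [mem_range] at *
    split_ifs with h
    · simp [h]
    · congr 1
      rw [inv_eq_iff_mul_eq_one, ← pow_add, show j + (n - j) = n by omega, ho]

lemma SW_eq (p : ℕ) [Fact p.Prime] (F : Type) [Field F] [Fintype F] [Algebra (ZMod p) F]
    (ω : MulChar F ℂ) (t : ℕ) (hcard : Fintype.card F = 6 * t + 1) (lam : F) :
    SW p F ω 6 (fun _ => 1) (![0,0,0,0,1,5] : Fin 6 → ZMod 6) lam =
      ((Fintype.card F : ℂ) - 1)⁻¹ * ∑ j ∈ Finset.range (6 * t), Tm (psi p F) (ω ^ t) lam (ω ^ j) := by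
  unfold SW
  rw [show Fintype.card F - 1 = 6 * t by omega, show 6 * t / 6 = t by omega]
  congr 1
  apply Finset.sum_congr rfl
  intro j _
  rw [Fin.prod_univ_six]
  have hj6 : ω ^ (6 * j) = (ω ^ j) ^ 6 := by rw [← pow_mul, mul_comm]
  have e0 : ((![0,0,0,0,1,5] : Fin 6 → ZMod 6) 0).val = 0 := rfl
  have e1 : ((![0,0,0,0,1,5] : Fin 6 → ZMod 6) 1).val = 0 := rfl
  have e2 : ((![0,0,0,0,1,5] : Fin 6 → ZMod 6) 2).val = 0 := rfl
  have e3 : ((![0,0,0,0,1,5] : Fin 6 → ZMod 6) 3).val = 0 := rfl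
  have e4 : ((![0,0,0,0,1,5] : Fin 6 → ZMod 6) 4).val = 1 := rfl
  have e5 : ((![0,0,0,0,1,5] : Fin 6 → ZMod 6) 5).val = 5 := rfl
  rw [e0, e1, e2, e3, e4, e5, hj6]
  have h1 : ω ^ (1 * t + 1 * j) = ω ^ j * ω ^ t := by rw [← pow_add]; congr 1; ring
  have h5 : ω ^ (5 * t + 1 * j) = ω ^ j * (ω ^ t) ^ 5 := by rw [← pow_mul, ← pow_add]; congr 1; ring
  have h0 : ω ^ (0 * t + 1 * j) = ω ^ j := by congr 1; ring
  rw [h0, h1, h5]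
  simp only [gaussChar_eq]
  unfold Tm
  push_cast
  ring

lemma NqW_eq (p : ℕ) [Fact p.Prime] (F : Type) [Field F] [Fintype F] [Algebra (ZMod p) F]
    (ω : MulChar F ℂ) (t : ℕ) (hcard : Fintype.card F = 6 * t + 1) (w : Fin 6 → ZMod 6)
    (a b c : ℕ) (hw : ∀ i, (w i).val = (![a, a, a, a, b, c] : Fin 6 → ℕ) i)
    (ha : 0 < a) (hb : 0 < b) (hc : 0 < c) (hb' : ω ^ (b * t) = (ω ^ t) ^ a * ω ^ t)
    (hc' : ω ^ (c * t) = (ω ^ t) ^ a * (ω ^ t) ^ 5) :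
    NqW p F ω 6 w = Nk (psi p F) (ω ^ t) ((ω ^ t) ^ a) := by
  have hne : ∀ i, w i ≠ 0 := by
    intro i h
    have := hw i
    rw [h, ZMod.val_zero] at this
    fin_cases i <;> simp at this <;> omega
  have ha' : ω ^ (a * t) = (ω ^ t) ^ a := by rw [← pow_mul, mul_comm]
  unfold NqW
  rw [if_neg (fun h => hne 0 (h 0)), if_pos hne, Fin.prod_univ_six,
    show Fintype.card F - 1 = 6 * t by omega, show 6 * t / 6 = t by omega]
  have e0 : (w 0).val = a := hw 0
  have e1 : (w 1).val = a := hw 1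
  have e2 : (w 2).val = a := hw 2
  have e3 : (w 3).val = a := hw 3
  have e4 : (w 4).val = b := hw 4
  have e5 : (w 5).val = c := hw 5
  rw [e0, e1, e2, e3, e4, e5, ha', hb', hc']
  simp only [gaussChar_eq]
  unfold Nk
  ring

end HD

/-- The contribution of the class of `w = (0,0,0,0,1,5)` in Koblitz's formula. -/
theorem class_000015 (p e q t : ℕ) [Fact p.Prime] (F : Type) [Field F] [Fintype F]
    [Algebra (ZMod p) F]
    (he : 0 < e) (hq : q = Fintype.card F) (hqe : q = p ^ e) (hmod : q % 6 = 1)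
    (ht : t = (q - 1) / 6)
    (ω : MulChar F ℂ) (hω : ∀ χ : MulChar F ℂ, ∃ j : ℕ, χ = ω ^ j)
    (ω₆ ω₃ ω₂ : MulChar F ℂ)
    (hω₆ : ω₆ = ω ^ t) (hω₃ : ω₃ = ω ^ (2 * t)) (hω₂ : ω₂ = ω ^ (3 * t))
    (lam : F) (hlam : lam ≠ 0) (hlam6 : lam ^ 6 ≠ 1) :
    (∑ k ∈ Finset.range 6, NqW p F ω 6 (fun i => (![0,0,0,0,1,5] : Fin 6 → ZMod 6) i + (k : ZMod 6))) +
      SW p F ω 6 (fun _ => 1) (![0,0,0,0,1,5] : Fin 6 → ZMod 6) lam =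
      (q : ℂ) ^ 3 * ω₆ (-1) * greeneF F ω ![ω₃, ω₂, ω₃⁻¹] ![1, 1] (lam ^ 6)⁻¹ := by
  classical
  have hψ := HD.psi_prim p F
  set ψ := HD.psi p F with hψd
  have hord := HD.order_omega ω hω
  have hcard : Fintype.card F = 6 * t + 1 := by omega
  have hqF : ((Fintype.card F : ℕ) : F) = 0 := Nat.cast_card_eq_zero F
  have ht0 : 0 < t := by
    have : 1 < Fintype.card F := Fintype.one_lt_card
    omega
  rw [hcard] at hqF hord
  push_cast at hqF
  have h2 : (2 : F) ≠ 0 := by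
    intro h; apply one_ne_zero (α := F); linear_combination hqF - 3 * (t : F) * h
  have h3 : (3 : F) ≠ 0 := by
    intro h; apply one_ne_zero (α := F); linear_combination hqF - 2 * (t : F) * h
  have hord' : orderOf ω = 6 * t := by omega
  set α : MulChar F ℂ := ω ^ t with hαd
  have hne : ∀ m, 0 < m → m < 6 → α ^ m ≠ 1 := by
    intro m h0 h6
    rw [hαd, ← pow_mul]
    apply pow_ne_one_of_lt_orderOf
    · positivity
    · rw [hord']; nlinarith
  have hα : α ^ 6 = 1 := by rw [hαd, ← pow_mul, mul_comm, ← hord', pow_orderOf_eq_one]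
  have hα1 : α ≠ 1 := by simpa using hne 1 (by norm_num) (by norm_num)
  have hα2 := hne 2 (by norm_num) (by norm_num)
  have hα3 := hne 3 (by norm_num) (by norm_num)
  have hpow : ∀ k, ω ^ (k * t) = α ^ k := by intro k; rw [hαd, ← pow_mul, mul_comm]
  have ht' : (Fintype.card F - 1) / 6 = t := by omega
  have hα7 : α ^ 7 = α := by rw [show 7 = 6 + 1 by norm_num, pow_add, hα, one_mul, pow_one]
  have hα8 : α ^ 8 = α ^ 2 := by rw [show 8 = 6 + 2 by norm_num, pow_add, hα, one_mul]
  have hα9 : α ^ 9 = α ^ 3 := by rw [show 9 = 6 + 3 by norm_num, pow_add, hα, one_mul]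
  -- the `N_q` part
  have hN : (∑ k ∈ Finset.range 6,
      NqW p F ω 6 (fun i => (![0,0,0,0,1,5] : Fin 6 → ZMod 6) i + (k : ZMod 6))) =
      HD.Nk ψ α (α ^ 2) + HD.Nk ψ α (α ^ 3) + HD.Nk ψ α (α ^ 4) := by
    have z0 : NqW p F ω 6 (fun i => (![0,0,0,0,1,5] : Fin 6 → ZMod 6) i + ((0 : ℕ) : ZMod 6)) = 0 := by
      unfold NqW; rw [if_neg (by decide), if_neg (by decide)]
    have z1 : NqW p F ω 6 (fun i => (![0,0,0,0,1,5] : Fin 6 → ZMod 6) i + ((1 : ℕ) : ZMod 6)) = 0 := by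
      unfold NqW; rw [if_neg (by decide), if_neg (by decide)]
    have z5 : NqW p F ω 6 (fun i => (![0,0,0,0,1,5] : Fin 6 → ZMod 6) i + ((5 : ℕ) : ZMod 6)) = 0 := by
      unfold NqW; rw [if_neg (by decide), if_neg (by decide)]
    have z2 : NqW p F ω 6 (fun i => (![0,0,0,0,1,5] : Fin 6 → ZMod 6) i + ((2 : ℕ) : ZMod 6)) =
        HD.Nk ψ α (α ^ 2) := by
      refine HD.NqW_eq p F ω t hcard _ 2 3 1 (by decide) (by norm_num) (by norm_num) (by norm_num) ?_ ?_
      · rw [hpow, ← hαd, ← pow_succ]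
      · rw [hpow, ← hαd, ← pow_add, show 2 + 5 = 6 + 1 by norm_num, pow_add, hα, one_mul]
    have z3 : NqW p F ω 6 (fun i => (![0,0,0,0,1,5] : Fin 6 → ZMod 6) i + ((3 : ℕ) : ZMod 6)) =
        HD.Nk ψ α (α ^ 3) := by
      refine HD.NqW_eq p F ω t hcard _ 3 4 2 (by decide) (by norm_num) (by norm_num) (by norm_num) ?_ ?_
      · rw [hpow, ← hαd, ← pow_succ]
      · rw [hpow, ← hαd, ← pow_add, show 3 + 5 = 6 + 2 by norm_num, pow_add, hα, one_mul]
    have z4 : NqW p F ω 6 (fun i => (![0,0,0,0,1,5] : Fin 6 → ZMod 6) i + ((4 : ℕ) : ZMod 6)) =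
        HD.Nk ψ α (α ^ 4) := by
      refine HD.NqW_eq p F ω t hcard _ 4 5 3 (by decide) (by norm_num) (by norm_num) (by norm_num) ?_ ?_
      · rw [hpow, ← hαd, ← pow_succ]
      · rw [hpow, ← hαd, ← pow_add, show 4 + 5 = 6 + 3 by norm_num, pow_add, hα, one_mul]
    simp only [Finset.sum_range_succ, Finset.sum_range_zero]
    rw [z0, z1, z2, z3, z4, z5]; ring
  -- the `S` part
  have hS : SW p F ω 6 (fun _ => 1) (![0,0,0,0,1,5] : Fin 6 → ZMod 6) lam =
      ((Fintype.card F : ℂ) - 1)⁻¹ * ∑ j ∈ Finset.range (6 * t), HD.Tm ψ α lam (ω ^ j) := by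
    exact HD.SW_eq p F ω t hcard lam
  -- comparison of terms
  have hT : ∀ j ∈ Finset.range (6 * t), HD.Tm ψ α lam (ω ^ j) = HD.Rm ψ α lam (ω ^ j) -
      ((Fintype.card F : ℂ) - 1) * ((if j = 2 * t then HD.Nk ψ α (α ^ 2) else 0) +
        (if j = 3 * t then HD.Nk ψ α (α ^ 3) else 0) + (if j = 4 * t then HD.Nk ψ α (α ^ 4) else 0)) := by
    intro j hj
    rw [Finset.mem_range] at hj
    by_cases j2 : j = 2 * t
    · rw [if_pos j2, if_neg (by omega), if_neg (by omega), j2, hpow,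
        HD.T_exc hψ h2 h3 hα hα1 hα2 hα3 hlam 2 (by norm_num), add_zero, add_zero]
    by_cases j3 : j = 3 * t
    · rw [if_neg j2, if_pos j3, if_neg (by omega), j3, hpow,
        HD.T_exc hψ h2 h3 hα hα1 hα2 hα3 hlam 3 (by norm_num), add_zero, zero_add]
    by_cases j4 : j = 4 * t
    · rw [if_neg j2, if_neg j3, if_pos j4, j4, hpow,
        HD.T_exc hψ h2 h3 hα hα1 hα2 hα3 hlam 4 (by norm_num), add_zero, zero_add]
    have hk : ∀ k, j ≠ (6 - k) * t → 0 < k → k < 6 → ω ^ j * α ^ k ≠ 1 := by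
      intro k hjk hk0 hk6 h
      rw [← hpow, ← pow_add] at h
      have hd := orderOf_dvd_of_pow_eq_one h
      rw [hord'] at hd
      obtain ⟨c, hc⟩ := hd
      have hkt : k * t < 6 * t := Nat.mul_lt_mul_of_pos_right hk6 ht0
      have hkt0 : 0 < k * t := Nat.mul_pos hk0 ht0
      have c1 : c = 1 := by
        have : c < 2 := by
          by_contra hcc
          have : 6 * t * 2 ≤ 6 * t * c := Nat.mul_le_mul_left _ (by omega)
          omega
        have : c ≠ 0 := by rintro rfl; omega
        omega
      subst c1
      apply hjk
      rw [Nat.sub_mul]; omega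
    rw [if_neg j2, if_neg j3, if_neg j4, HD.T_gen hψ h2 h3 hα hα2 hα3 lam (ω ^ j)
      (hk 2 (by omega) (by norm_num) (by norm_num)) (hk 3 (by omega) (by norm_num) (by norm_num))
      (hk 4 (by omega) (by norm_num) (by norm_num))]
    ring
  have hq1 : (Fintype.card F : ℂ) - 1 ≠ 0 := by
    rw [hcard]; push_cast
    have : (t : ℂ) ≠ 0 := Nat.cast_ne_zero.2 ht0.ne'
    simpa using this
  -- the hypergeometric part
  have hG : (q : ℂ) ^ 3 * ω₆ (-1) * greeneF F ω ![ω₃, ω₂, ω₃⁻¹] ![1, 1] (lam ^ 6)⁻¹ =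
      ((Fintype.card F : ℂ) - 1)⁻¹ * ∑ j ∈ Finset.range (6 * t), HD.Rm ψ α lam (ω ^ j) := by
    rw [← HD.sum_inv ω (by omega) (by rw [← hord', pow_orderOf_eq_one]) (HD.Rm ψ α lam)]
    unfold greeneF
    rw [show Fintype.card F - 1 = 6 * t by omega, hω₆, hω₃, hω₂, hpow, hpow, hq]
    simp_rw [← HD.greene_term hψ hα hα2 hα3 lam]
    rw [← Finset.mul_sum]
    have : ∀ j ∈ Finset.range (6 * t),
        gBinom F ((![α ^ 2, α ^ 3, (α ^ 2)⁻¹] : Fin 3 → MulChar F ℂ) 0 * ω ^ j) (ω ^ j) *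
        (∏ i : Fin 2, gBinom F ((![α ^ 2, α ^ 3, (α ^ 2)⁻¹] : Fin 3 → MulChar F ℂ) i.succ * ω ^ j)
          ((![1, 1] : Fin 2 → MulChar F ℂ) i * ω ^ j)) * (ω ^ j) (lam ^ 6)⁻¹ =
        gBinom F (α ^ 2 * ω ^ j) (ω ^ j) * (gBinom F (α ^ 3 * ω ^ j) (ω ^ j) *
          gBinom F ((α ^ 2)⁻¹ * ω ^ j) (ω ^ j)) * (ω ^ j) (lam ^ 6)⁻¹ := by
      intro j _
      rw [Fin.prod_univ_two]
      simp
    rw [Finset.sum_congr rfl this]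
    ring
  rw [hN, hS, hG, Finset.sum_congr rfl hT, Finset.sum_sub_distrib, ← Finset.mul_sum,
    Finset.sum_add_distrib, Finset.sum_add_distrib, Finset.sum_ite_eq', Finset.sum_ite_eq',
    Finset.sum_ite_eq', if_pos (Finset.mem_range.2 (by omega)), if_pos (Finset.mem_range.2 (by omega)),
    if_pos (Finset.mem_range.2 (by omega))]
  field_simp
  ring
end

section
/- Let q = p^e be a power of a prime with q ≡ 1 (mod 6), t = (q-1)/6, ω₆ = ω^t, ω₃ = ω^{2t}, ω₂ = ω^{3t}, and let λ ∈ 𝔽_q with λ ≠ 0 and λ⁶ ≠ 1. For the equivalence class of w = (0,0,0,0,2,4): Σ_{w'∈[0,0,0,0,2,4]} N_q(0,w') + S_{[0,0,0,0,2,4]} = q³·₃F₂(ω₆,ω₂,ω̄₆; ε,ε | 1/λ⁶)_q. -/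
open scoped Classical

section HD
set_option linter.unusedSectionVars false
variable {F : Type} [Field F] [Fintype F]

lemma hd_unique2 {A φ : MulChar F ℂ} (hφ : φ ≠ 1) (hφ2 : φ ^ 2 = 1) (hA : A ^ 2 = 1) (hA1 : A ≠ 1) :
    A = φ := by
  obtain ⟨g, hg⟩ := IsCyclic.exists_generator (α := Fˣ)
  have key : ∀ B : MulChar F ℂ, B ≠ 1 → B ^ 2 = 1 → B g = -1 := by
    intro B hB hB2
    have h1 : (B g) ^ 2 = 1 := by
      rw [← MulChar.pow_apply_coe, hB2, MulChar.one_apply_coe]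
    rcases sq_eq_sq_iff_eq_or_eq_neg.mp (h1.trans (one_pow 2).symm) with h | h
    · exfalso; apply hB
      rw [MulChar.eq_iff hg, h, MulChar.one_apply_coe]
    · exact h
  rw [MulChar.eq_iff hg, key A hA1 hA, key φ hφ hφ2]

lemma hd_unique3 {A ρ : MulChar F ℂ} (hρ : ρ ≠ 1) (hρ3 : ρ ^ 3 = 1) (hA : A ^ 3 = 1) :
    A = 1 ∨ A = ρ ∨ A = ρ ^ 2 := by
  obtain ⟨g, hg⟩ := IsCyclic.exists_generator (α := Fˣ)
  have h3 : ∀ B : MulChar F ℂ, B ^ 3 = 1 → B g ^ 3 = 1 := by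
    intro B hB
    rw [← MulChar.pow_apply_coe, hB, MulChar.one_apply_coe]
  have hr : ρ g ≠ 1 := by
    intro h; apply hρ
    rw [MulChar.eq_iff hg, h, MulChar.one_apply_coe]
  have hr3 := h3 ρ hρ3
  have ha3 := h3 A hA
  rw [MulChar.eq_iff hg, MulChar.eq_iff hg, MulChar.eq_iff hg, MulChar.one_apply_coe, 
    MulChar.pow_apply_coe]
  generalize ρ g = r at *
  generalize A g = a at *
  have hr2 : r ^ 2 + r + 1 = 0 := by
    have : (r - 1) * (r ^ 2 + r + 1) = 0 := by linear_combination hr3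
    exact (mul_eq_zero.mp this).resolve_left (sub_ne_zero.mpr hr)
  have : (a - 1) * ((a - r) * (a - r ^ 2)) = 0 := by
    linear_combination ha3 + (-a^2 + a *r - r+1) * hr2 
  rcases mul_eq_zero.mp this with h | h
  · left; linear_combination h
  · right
    rcases mul_eq_zero.mp h with h | h
    · left; linear_combination h
    · right; linear_combination h

lemma card_mulChar_eq [Fintype (MulChar F ℂ)] : Fintype.card (MulChar F ℂ) = Fintype.card F - 1 := by
  rw [← Nat.card_eq_fintype_card, MulChar.card_eq_card_units_of_hasEnoughRootsOfUnity,
    Nat.card_eq_fintype_card, Fintype.card_units]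

lemma sum_mulChar_apply [Fintype (MulChar F ℂ)] (a : F) :
    ∑ χ : MulChar F ℂ, χ a = if a = 1 then (Fintype.card F : ℂ) - 1 else 0 := by
  split_ifs with h
  · subst h
    simp [card_mulChar_eq, Nat.cast_sub Fintype.card_pos]
  · by_cases h0 : a = 0
    · subst h0; exact Finset.sum_eq_zero fun χ _ => χ.map_zero
    obtain ⟨η, hη⟩ := MulChar.exists_apply_ne_one_of_hasEnoughRootsOfUnity F ℂ h
    have : η a * ∑ χ : MulChar F ℂ, χ a = ∑ χ : MulChar F ℂ, χ a := by
      rw [Finset.mul_sum]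
      exact Fintype.sum_equiv (Equiv.mulLeft η) _ _ (fun x => by simp)
    have h2 : (η a - 1) * ∑ χ : MulChar F ℂ, χ a = 0 := by linear_combination this
    exact (mul_eq_zero.mp h2).resolve_left (sub_ne_zero.mpr hη)

variable {ψ : AddChar F ℂ}

lemma card_ne_zeroC : (Fintype.card F : ℂ) ≠ 0 := by
  exact_mod_cast Fintype.card_ne_zero

lemma gauss_one (hψ : ψ.IsPrimitive) : gaussSum (1 : MulChar F ℂ) ψ = -1 := by
  apply gaussSum_one_left
  have := hψ (one_ne_zero)
  rwa [AddChar.mulShift_one] at this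

lemma gauss_ne_zero (hψ : ψ.IsPrimitive) (χ : MulChar F ℂ) : gaussSum χ ψ ≠ 0 := by
  by_cases h : χ = 1
  · rw [h, gauss_one hψ]; norm_num
  · exact gaussSum_ne_zero_of_nontrivial card_ne_zeroC h hψ

lemma char_neg_one_sq (χ : MulChar F ℂ) : χ (-1) * χ (-1) = 1 := by
  rw [← map_mul]; simp

lemma gauss_mul_inv (hψ : ψ.IsPrimitive) {χ : MulChar F ℂ} (h : χ ≠ 1) :
    gaussSum χ ψ * gaussSum χ⁻¹ ψ = χ (-1) * Fintype.card F := by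
  have h1 := gaussSum_mul_gaussSum_eq_card h hψ
  have h2 := mul_gaussSum_inv_eq_gaussSum χ⁻¹ ψ
  rw [MulChar.inv_apply', inv_neg_one] at h2
  rw [← h1, ← h2]; ring

lemma jacobi_double (h2 : (2 : F) ≠ 0) {φ : MulChar F ℂ} (hφ : φ ≠ 1) (hφ2 : φ ^ 2 = 1)
    {A : MulChar F ℂ} (hA : A ≠ 1) : A 4 * jacobiSum A A = jacobiSum A φ := by
  have hchar : ringChar F ≠ 2 := by
    intro h
    apply h2
    have := ringChar.Nat.cast_ringChar (R := F)
    rw [h] at this; exact_mod_cast this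
  have hφq : φ = (quadraticChar F).ringHomComp (Int.castRingHom ℂ) := by
    symm
    apply hd_unique2 hφ hφ2
    · rw [MulChar.ringHomComp_pow, (quadraticChar_isQuadratic F).sq_eq_one, MulChar.ringHomComp_one]
    · exact (MulChar.ringHomComp_ne_one_iff (Int.cast_injective)).mpr (quadraticChar_ne_one hchar)
  have hcount : ∀ w : F, ((Finset.univ.filter (fun u : F => u ^ 2 = w)).card : ℂ) = φ w + 1 := by
    intro w
    have := quadraticChar_card_sqrts hchar w
    rw [hφq]
    simp only [MulChar.ringHomComp_apply, eq_intCast]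
    have h3 : ((Finset.univ.filter (fun u : F => u ^ 2 = w)).card : ℤ) = quadraticChar F w + 1 := by
      rw [← this]; congr 2; ext; simp
    exact_mod_cast h3
  calc A 4 * jacobiSum A A = ∑ x : F, A (1 - (2 * x - 1) ^ 2) := by
        rw [jacobiSum, Finset.mul_sum]
        refine Finset.sum_congr rfl fun x _ => ?_
        rw [← map_mul, ← map_mul]; congr 1; ring
    _ = ∑ u : F, A (1 - u ^ 2) := by
        refine Fintype.sum_bijective (fun x => 2 * x - 1) ?_ _ _ (fun x => rfl)
        refine ⟨fun a b h => ?_, fun b => ⟨(b + 1) / 2, ?_⟩⟩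
        · have : 2 * (a - b) = 0 := by linear_combination h
          exact sub_eq_zero.mp ((mul_eq_zero.mp this).resolve_left h2)
        · field_simp; ring
    _ = ∑ w : F, (φ w + 1) * A (1 - w) := by
        rw [← Finset.sum_fiberwise Finset.univ (fun u : F => u ^ 2)]
        refine Finset.sum_congr rfl fun w _ => ?_
        rw [← hcount w, Finset.sum_congr rfl (g := fun _ => A (1 - w)), Finset.sum_const, nsmul_eq_mul]
        intro u hu
        rw [(Finset.mem_filter.mp hu).2]
    _ = jacobiSum A φ := by
        rw [jacobiSum_comm, jacobiSum]
        simp only [add_mul, Finset.sum_add_distrib, one_mul]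
        have : ∑ w : F, A (1 - w) = ∑ w : F, A w :=
          Fintype.sum_equiv (Equiv.subLeft 1) _ _ (fun x => by simp)
        rw [this, MulChar.sum_eq_zero_of_ne_one hA, add_zero]

lemma hd2 (hψ : ψ.IsPrimitive) (h2 : (2 : F) ≠ 0) {φ : MulChar F ℂ} (hφ : φ ≠ 1) (hφ2 : φ ^ 2 = 1)
    (A : MulChar F ℂ) :
    gaussSum A ψ * gaussSum (A * φ) ψ * A 4 = gaussSum (A ^ 2) ψ * gaussSum φ ψ := by
  by_cases hA : A ^ 2 = 1
  · have h4 : A 4 = 1 := by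
      have : (4 : F) = 2 * 2 := by norm_num
      rw [this, map_mul, ← sq, ← MulChar.pow_apply' A two_ne_zero, hA, MulChar.one_apply (IsUnit.mk0 _ h2)]
    rw [h4, hA, gauss_one hψ]
    by_cases h1 : A = 1
    · subst h1; rw [gauss_one hψ, one_mul]; ring
    · have := hd_unique2 hφ hφ2 hA h1
      subst this
      rw [← sq, hA, gauss_one hψ]; ring
  · have hA1 : A ≠ 1 := by rintro rfl; simp at hA
    have hAφ : A * φ ≠ 1 := by
      intro h
      apply hA
      have : A = φ⁻¹ := eq_inv_of_mul_eq_one_left h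
      rw [this, inv_pow, hφ2, inv_one]
    have e1 := jacobi_double h2 hφ hφ2 hA1
    have e2 := jacobiSum_mul_nontrivial (χ := A) (φ := A) (by rwa [← sq]) ψ
    have e3 := jacobiSum_mul_nontrivial hAφ ψ
    rw [← sq] at e2
    have := gauss_ne_zero hψ A
    apply mul_left_cancel₀ this
    rw [← e1] at e3
    linear_combination (-A 4 * gaussSum (A * φ) ψ) * e2 + gaussSum (A^2) ψ * e3

lemma node_card (h3 : (3 : F) ≠ 0) {ζ : F} (hζ : ζ ^ 2 + ζ + 1 = 0) :
    ((Finset.univ.filter (fun v : F × F => v.1 * v.2 * (3 - v.1 - v.2) = 1)).card : ℂ)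
      = (Fintype.card F : ℂ) - 3 := by
  have hζ0 : ζ ≠ 0 := by rintro rfl; simp at hζ
  have hz2 : ζ ≠ -1 - ζ := by
    intro h
    apply h3
    linear_combination 4 * hζ - (1 + 2 * ζ) * h
  have hroot : ∀ s : F, s ^ 2 + s + 1 = 0 ↔ s = ζ ∨ s = -1 - ζ := by
    intro s
    constructor
    · intro h
      have : (s - ζ) * (s - (-1 - ζ)) = 0 := by linear_combination h - hζ
      rcases mul_eq_zero.mp this with h | h
      · left; linear_combination h
      · right; linear_combination h
    · rintro (rfl | rfl)
      · exact hζ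
      · linear_combination hζ
  have hz1 : ζ ≠ -1 := by rintro rfl; simp at hζ
  let T : Finset F := {0, -1, ζ, -1 - ζ}
  have hT : T.card = 4 := by
    have a1 : (0 : F) ≠ -1 := by simp
    have a2 : (0 : F) ≠ -1 - ζ := fun h => hz1 (by linear_combination h)
    have a3 : (-1 : F) ≠ -1 - ζ := fun h => hζ0 (by linear_combination h)
    simp only [T]
    rw [Finset.card_insert_of_notMem, Finset.card_insert_of_notMem, Finset.card_insert_of_notMem,
      Finset.card_singleton]
    · simpa using hz2
    · simp only [Finset.mem_insert, Finset.mem_singleton, not_or]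
      exact ⟨hz1.symm, a3⟩
    · simp only [Finset.mem_insert, Finset.mem_singleton, not_or]
      exact ⟨a1, hζ0.symm, a2⟩
  have hmem : ∀ s : F, s ∈ Tᶜ ↔ s ≠ 0 ∧ s + 1 ≠ 0 ∧ s ^ 2 + s + 1 ≠ 0 := by
    intro s
    simp only [T, Finset.mem_compl, Finset.mem_insert, Finset.mem_singleton, not_or, ne_eq, hroot,
      add_eq_zero_iff_eq_neg]
  set S := Finset.univ.filter (fun v : F × F => v.1 * v.2 * (3 - v.1 - v.2) = 1) with hS
  have h11 : ((1, 1) : F × F) ∈ S := by simp [S]; norm_num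
  have hne : ∀ v ∈ S.erase (1, 1), v.2 - 1 ≠ 0 ∧ v.1 - 1 ≠ 0 := by
    rintro ⟨y, z⟩ hv
    simp only [S, Finset.mem_erase, Finset.mem_filter, Finset.mem_univ, true_and, ne_eq, 
      Prod.mk.injEq, not_and] at hv
    obtain ⟨hv1, hv2⟩ := hv
    constructor
    · intro h
      have hz : z = 1 := by linear_combination h
      subst hz
      have : (y - 1) ^ 2 = 0 := by linear_combination -hv2
      exact hv1 (by linear_combination (pow_eq_zero_iff two_ne_zero).mp this) rfl
    · intro h
      have hz : y = 1 := by linear_combination h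
      subst hz
      have : (z - 1) ^ 2 = 0 := by linear_combination -hv2
      exact hv1 rfl (by linear_combination (pow_eq_zero_iff two_ne_zero).mp this)
  have hcard : (S.erase (1, 1)).card = (Tᶜ).card := by
    refine Finset.card_bij' (fun v _ => (v.1 - 1) / (v.2 - 1))
      (fun s _ => (-s ^ 2 / (s + 1), -1 / (s * (s + 1)))) ?_ ?_ ?_ ?_
    · rintro ⟨y, z⟩ hv
      obtain ⟨hz, hy⟩ := hne _ hv
      simp only [S, Finset.mem_erase, Finset.mem_filter, Finset.mem_univ, true_and] at hv hz hy
      have hv2 := hv.2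
      rw [hmem]
      refine ⟨div_ne_zero hy hz, ?_, ?_⟩
      · intro h
        have h' : y + z = 2 := by field_simp at h; linear_combination h
        have hy' : y = 2 - z := by linear_combination h'
        subst hy'
        have : (z - 1) ^ 2 = 0 := by linear_combination -hv2
        exact hz ((pow_eq_zero_iff two_ne_zero).mp this)
      · intro h
        have h' : (y - 1) ^ 2 + (y - 1) * (z - 1) + (z - 1) ^ 2 = 0 := by
          field_simp at h; linear_combination h
        have h5 : (y - 1) * (z - 1) * ((y - 1) + (z - 1)) = 0 := by
          linear_combination -hv2 - h'
        have h6 : (y - 1) + (z - 1) = 0 := by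
          rcases mul_eq_zero.mp h5 with h5 | h5
          · rcases mul_eq_zero.mp h5 with h5 | h5
            · exact absurd h5 hy
            · exact absurd h5 hz
          · exact h5
        have hy' : y = 2 - z := by linear_combination h6
        subst hy'
        have : (z - 1) ^ 2 = 0 := by linear_combination -hv2
        exact hz ((pow_eq_zero_iff two_ne_zero).mp this)
    · intro s hs
      obtain ⟨a, b, c⟩ := (hmem s).mp hs
      simp only [S, Finset.mem_erase, Finset.mem_filter, Finset.mem_univ, true_and, ne_eq, 
        Prod.mk.injEq, not_and]
      constructor
      · intro h
        exfalso; apply c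
        field_simp at h
        linear_combination -h
      · field_simp
        ring
    · rintro ⟨y, z⟩ hv
      obtain ⟨hz, hy⟩ := hne _ hv
      simp only [S, Finset.mem_erase, Finset.mem_filter, Finset.mem_univ, true_and] at hv hz hy
      have hv2 := hv.2
      have hb : y - 1 + (z - 1) ≠ 0 := by
        intro h
        have hy' : y = 2 - z := by linear_combination h
        subst hy'
        have : (z - 1) ^ 2 = 0 := by linear_combination -hv2
        exact hz ((pow_eq_zero_iff two_ne_zero).mp this)
      have hb' : (y - 1) / (z - 1) + 1 ≠ 0 := by
        intro h; apply hb; field_simp at h; linear_combination h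
      have e : (y - 1) / (z - 1) + 1 = (y - 1 + (z - 1)) / (z - 1) := by field_simp
      simp only [Prod.mk.injEq]
      rw [e]
      constructor
      · field_simp
        linear_combination hv2
      · field_simp
        linear_combination hv2
    · intro s hs
      obtain ⟨a, b, c⟩ := (hmem s).mp hs
      have e1 : -s ^ 2 / (s + 1) - 1 = -(s ^ 2 + s + 1) / (s + 1) := by field_simp; ring
      have e2 : -1 / (s * (s + 1)) - 1 = -(s ^ 2 + s + 1) / (s * (s + 1)) := by field_simp; ring
      simp only []
      rw [e1, e2, div_div_div_eq, div_eq_iff (mul_ne_zero b (neg_ne_zero.mpr c))]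
      ring
  rw [Finset.card_erase_of_mem h11, Finset.card_compl, hT] at hcard
  have hS1 : 1 ≤ S.card := Finset.card_pos.mpr ⟨_, h11⟩
  have h4 : 4 ≤ Fintype.card F := hT ▸ Finset.card_le_univ T
  have : S.card + 3 = Fintype.card F := by omega
  rw [← this]; push_cast; ring

lemma node_cube {ρ : MulChar F ℂ} (hρ3 : ρ ^ 3 = 1) (y z : F) (h : y * z * (3 - y - z) = 1) :
    ρ y * (ρ ^ 2) z = 1 := by
  have hy : y ≠ 0 := by rintro rfl; simp at h
  have hz : z ≠ 0 := by rintro rfl; simp at h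
  have hc : ∀ u : F, u ≠ 0 → ρ u ^ 3 = 1 := by
    intro u hu
    rw [← MulChar.pow_apply' ρ three_ne_zero, hρ3, MulChar.one_apply (IsUnit.mk0 _ hu)]
  rw [MulChar.pow_apply' ρ two_ne_zero]
  by_cases hz1 : z - 1 = 0
  · have hz' : z = 1 := by linear_combination hz1
    subst hz'
    have : (y - 1) ^ 2 = 0 := by linear_combination -h
    have : y = 1 := by linear_combination (pow_eq_zero_iff two_ne_zero).mp this
    subst this
    simp
  have e : y * (z - 1) ^ 3 = z * (y - 1) ^ 3 := by
    linear_combination (y - z) * h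
  have hy1 : y - 1 ≠ 0 := by
    intro h0
    rw [h0] at e
    have : y * (z - 1) ^ 3 ≠ 0 := mul_ne_zero hy (pow_ne_zero _ hz1)
    apply this; rw [e]; ring
  have e2 := congrArg ρ e
  rw [map_mul, map_mul, map_pow, map_pow, hc _ hz1, hc _ hy1, mul_one, mul_one] at e2
  rw [e2, ← hc z hz]; ring

lemma inner_scale {ρ : MulChar F ℂ} (hρ : ρ ≠ 1) (hρ3 : ρ ^ 3 = 1) (c : ℂ) (v : F) :
    ∑ y : F, ∑ z : F, ∑ x : F, (if x * y * z * v⁻¹ ^ 3 = 1 then c else 0) *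
        (ρ y * (ρ ^ 2) z * ψ (x + y + z - 3 * v)) =
    ∑ y : F, ∑ z : F, ∑ x : F, (if x * y * z = 1 then c else 0) *
        (ρ y * (ρ ^ 2) z * ψ (v * (x + y + z - 3))) := by
  by_cases hv : v = 0
  · subst hv
    trans 0
    · refine Finset.sum_eq_zero fun y _ => Finset.sum_eq_zero fun z _ =>
        Finset.sum_eq_zero fun x _ => ?_
      simp
    · symm
      have : ∀ y z : F, ∑ x : F, (if x * y * z = 1 then c else 0) *
          (ρ y * (ρ ^ 2) z * ψ (0 * (x + y + z - 3))) = c * ρ y * (ρ ^ 2) z := by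
        intro y z
        by_cases hy : y = 0
        · subst hy; simp [MulChar.map_zero]
        by_cases hz : z = 0
        · subst hz; simp [MulChar.map_zero]
        rw [Finset.sum_eq_single ((y * z)⁻¹)]
        · rw [if_pos (by field_simp)]
          simp; ring
        · intro b _ hb
          rw [if_neg, zero_mul]
          intro h; apply hb
          field_simp; linear_combination h
        · simp
      simp only [this]
      rw [Finset.sum_comm]
      refine Finset.sum_eq_zero fun z _ => ?_
      rw [← Finset.sum_mul, ← Finset.mul_sum, MulChar.sum_eq_zero_of_ne_one hρ]
      simp
  · have hr : ρ v * (ρ ^ 2) v = 1 := by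
      rw [← MulChar.mul_apply, ← pow_succ', hρ3, MulChar.one_apply (IsUnit.mk0 _ hv)]
    rw [← Equiv.sum_comp (Equiv.mulLeft₀ v hv)]
    refine Finset.sum_congr rfl fun y _ => ?_
    rw [← Equiv.sum_comp (Equiv.mulLeft₀ v hv)]
    refine Finset.sum_congr rfl fun z _ => ?_
    rw [← Equiv.sum_comp (Equiv.mulLeft₀ v hv)]
    refine Finset.sum_congr rfl fun x _ => ?_
    simp only [Equiv.mulLeft₀_apply, map_mul]
    have e1 : v * x * (v * y) * (v * z) * v⁻¹ ^ 3 = x * y * z := by field_simp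
    have e2 : v * x + v * y + v * z - 3 * v = v * (x + y + z - 3) := by ring
    rw [e1, e2]
    congr 1
    linear_combination (ρ y * (ρ ^ 2) z * ψ (v * (x + y + z - 3))) * hr

lemma sum_triple_aux (a : ℂ) (f g h : F → ℂ) :
    a * ((∑ x, f x) * (∑ y, g y) * (∑ z, h z)) =
      ∑ y : F, ∑ z : F, ∑ x : F, a * (f x * g y * h z) := by
  simp only [← Finset.mul_sum, ← Finset.sum_mul]

lemma gauss_expand (ρ : MulChar F ℂ) (χ : MulChar F ℂ) :
    gaussSum χ ψ * gaussSum (χ * ρ) ψ * gaussSum (χ * ρ ^ 2) ψ *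
      gaussSum (χ ^ 3)⁻¹ (ψ.mulShift (-3)) =
    ∑ v : F, ∑ y : F, ∑ z : F, ∑ x : F, χ (x * y * z * v⁻¹ ^ 3) *
      (ρ y * (ρ ^ 2) z * ψ (x + y + z - 3 * v)) := by
  rw [mul_comm]
  unfold gaussSum
  rw [Finset.sum_mul]
  refine Finset.sum_congr rfl fun v _ => ?_
  rw [sum_triple_aux]
  refine Finset.sum_congr rfl fun y _ => Finset.sum_congr rfl fun z _ =>
    Finset.sum_congr rfl fun x _ => ?_
  have e : x + y + z - 3 * v = x + y + z + (-3) * v := by ring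
  rw [e, AddChar.map_add_eq_mul, AddChar.map_add_eq_mul, AddChar.map_add_eq_mul,
    MulChar.inv_apply', MulChar.pow_apply' χ three_ne_zero, AddChar.mulShift_apply]
  simp only [MulChar.mul_apply, map_mul, map_pow]
  ring

lemma e_sum [Fintype (MulChar F ℂ)] (hψ : ψ.IsPrimitive) (h3 : (3 : F) ≠ 0) {ζ : F}
    (hζ : ζ ^ 2 + ζ + 1 = 0) {ρ : MulChar F ℂ} (hρ : ρ ≠ 1) (hρ3 : ρ ^ 3 = 1) :
    ∑ χ : MulChar F ℂ, gaussSum χ ψ * gaussSum (χ * ρ) ψ * gaussSum (χ * ρ ^ 2) ψ *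
      gaussSum (χ ^ 3)⁻¹ (ψ.mulShift (-3)) =
    ((Fintype.card F : ℂ) - 1) * Fintype.card F * (Fintype.card F - 3) := by
  set q : ℂ := (Fintype.card F : ℂ) with hq
  calc _ = ∑ χ : MulChar F ℂ, ∑ v : F, ∑ y : F, ∑ z : F, ∑ x : F, χ (x * y * z * v⁻¹ ^ 3) *
      (ρ y * (ρ ^ 2) z * ψ (x + y + z - 3 * v)) := 
        Finset.sum_congr rfl fun χ _ => gauss_expand ρ χ
    _ = ∑ v : F, ∑ y : F, ∑ z : F, ∑ x : F, (if x * y * z * v⁻¹ ^ 3 = 1 then q - 1 else 0) *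
        (ρ y * (ρ ^ 2) z * ψ (x + y + z - 3 * v)) := by
        rw [Finset.sum_comm]
        refine Finset.sum_congr rfl fun v _ => ?_
        rw [Finset.sum_comm]
        refine Finset.sum_congr rfl fun y _ => ?_
        rw [Finset.sum_comm]
        refine Finset.sum_congr rfl fun z _ => ?_
        rw [Finset.sum_comm]
        refine Finset.sum_congr rfl fun x _ => ?_
        rw [← Finset.sum_mul, sum_mulChar_apply]
    _ = ∑ v : F, ∑ y : F, ∑ z : F, ∑ x : F, (if x * y * z = 1 then q - 1 else 0) *
        (ρ y * (ρ ^ 2) z * ψ (v * (x + y + z - 3))) :=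
        Finset.sum_congr rfl fun v _ => inner_scale hρ hρ3 _ v
    _ = ∑ y : F, ∑ z : F, ∑ x : F, (if x * y * z = 1 then q - 1 else 0) *
        (ρ y * (ρ ^ 2) z * (if x + y + z - 3 = 0 then q else 0)) := by
        rw [Finset.sum_comm]
        refine Finset.sum_congr rfl fun y _ => ?_
        rw [Finset.sum_comm]
        refine Finset.sum_congr rfl fun z _ => ?_
        rw [Finset.sum_comm]
        refine Finset.sum_congr rfl fun x _ => ?_
        rw [← Finset.mul_sum, ← Finset.mul_sum, AddChar.sum_mulShift _ hψ]
        push_cast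
        rfl
    _ = ∑ y : F, ∑ z : F, if y * z * (3 - y - z) = 1 then (q - 1) * q else 0 := by
        refine Finset.sum_congr rfl fun y _ => Finset.sum_congr rfl fun z _ => ?_
        rw [Finset.sum_eq_single (3 - y - z)]
        · have e : (3 - y - z) * y * z = y * z * (3 - y - z) := by ring
          rw [e, if_pos (by ring : 3 - y - z + y + z - 3 = 0)]
          split_ifs with h
          · rw [node_cube hρ3 y z h]; ring
          · simp
        · intro b _ hb
          rw [if_neg (c := b + y + z - 3 = 0)]
          · simp
          · intro h; apply hb; linear_combination h
        · simp
    _ = _ := by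
        rw [← Fintype.sum_prod_type' (f := fun y z => if y * z * (3 - y - z) = 1 then (q - 1) * q else 0),
          ← Finset.sum_filter, Finset.sum_const, nsmul_eq_mul, node_card h3 hζ]
        ring

lemma gauss_mul_star (hψ : ψ.IsPrimitive) {χ : MulChar F ℂ} (h : χ ≠ 1) :
    gaussSum χ ψ * star (gaussSum χ ψ) = Fintype.card F := by
  rw [star_gaussSum_eq, gaussSum_mul_gaussSum_eq_card h hψ]

lemma eq_of_sum_norm {ι : Type*} (s : Finset ι) (X : ι → ℂ) (r : ℝ)
    (hX : ∀ i ∈ s, X i * star (X i) = (r : ℂ) ^ 2) (hsum : ∑ i ∈ s, X i = s.card * r) :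
    ∀ i ∈ s, X i = r := by
  have h1 : ∑ i ∈ s, Complex.normSq (X i - r) = 0 := by
    have h2 : ((∑ i ∈ s, Complex.normSq (X i - r) : ℝ) : ℂ) = 0 := by
      push_cast
      have : ∀ i ∈ s, (Complex.normSq (X i - r) : ℂ) = 2 * r ^ 2 - r * X i - r * star (X i) := by
        intro i hi
        rw [← Complex.mul_conj, map_sub, Complex.conj_ofReal]
        have := hX i hi
        simp only [Complex.star_def] at this ⊢
        linear_combination this
      rw [Finset.sum_congr rfl this, Finset.sum_sub_distrib, Finset.sum_sub_distrib,
        ← Finset.mul_sum, ← Finset.mul_sum, ← Finset.mul_sum, ← star_sum, hsum,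
        Finset.sum_const]
      simp
      ring
    exact_mod_cast h2
  rw [Finset.sum_eq_zero_iff_of_nonneg (fun i _ => Complex.normSq_nonneg _)] at h1
  intro i hi
  exact sub_eq_zero.mp (Complex.normSq_eq_zero.mp (h1 i hi))

lemma hd3 (hψ : ψ.IsPrimitive) (h3 : (3 : F) ≠ 0) {ζ : F}
    (hζ : ζ ^ 2 + ζ + 1 = 0) {ρ : MulChar F ℂ} (hρ : ρ ≠ 1) (hρ3 : ρ ^ 3 = 1) (χ : MulChar F ℂ) :
    gaussSum χ ψ * gaussSum (χ * ρ) ψ * gaussSum (χ * ρ ^ 2) ψ * (χ ^ 3) 3 =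
      Fintype.card F * gaussSum (χ ^ 3) ψ := by
  have : Fintype (MulChar F ℂ) := Fintype.ofFinite _
  have h30 : (-3 : F) ≠ 0 := neg_ne_zero.mpr h3
  have hψ3 : (ψ.mulShift (-3)).IsPrimitive := by
    intro a ha
    rw [AddChar.mulShift_mulShift]
    exact hψ (mul_ne_zero h30 ha)
  set X : MulChar F ℂ → ℂ := fun χ => gaussSum χ ψ * gaussSum (χ * ρ) ψ * gaussSum (χ * ρ ^ 2) ψ *
      gaussSum (χ ^ 3)⁻¹ (ψ.mulShift (-3)) with hX
  have hr2 : ρ ^ 2 ≠ 1 := by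
    intro h; apply hρ
    have : ρ ^ 3 = ρ ^ 2 * ρ := pow_succ _ _
    rw [h, hρ3, one_mul] at this; exact this.symm
  have hrr : ρ ^ 2 ≠ ρ := by
    intro h; apply hρ
    rw [sq] at h; exact mul_eq_left.mp h
  have hinv : ρ ^ 2 = ρ⁻¹ := by
    rw [eq_inv_iff_mul_eq_one, ← pow_succ, hρ3]
  have hm1 : ρ (-1) = 1 := MulChar.val_neg_one_eq_one_of_odd_order (n := 3) (by decide) hρ3
  have hbase : gaussSum ρ ψ * gaussSum (ρ ^ 2) ψ = Fintype.card F := by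
    rw [hinv, gauss_mul_inv hψ hρ, hm1, one_mul]
  have htriple : ∀ A : MulChar F ℂ, A ^ 3 = 1 → 
      gaussSum A ψ * gaussSum (A * ρ) ψ * gaussSum (A * ρ ^ 2) ψ = - Fintype.card F := by
    intro A hA
    rcases hd_unique3 hρ hρ3 hA with rfl | rfl | rfl
    · rw [one_mul, one_mul, gauss_one hψ]; linear_combination -hbase
    · rw [← sq, ← pow_succ', hρ3, gauss_one hψ]; linear_combination -hbase
    · have e4 : ρ ^ 2 * ρ ^ 2 = ρ := by
        rw [← pow_add, show 2 + 2 = 3 + 1 from rfl, pow_succ, hρ3, one_mul]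
      rw [e4, ← pow_succ, hρ3, gauss_one hψ]
      linear_combination -hbase
  by_cases hχ : χ ^ 3 = 1
  · rw [htriple χ hχ, hχ, gauss_one hψ, MulChar.one_apply (IsUnit.mk0 _ h3)]; ring
  have hXt : ∀ A : MulChar F ℂ, A ^ 3 = 1 → X A = Fintype.card F := by
    intro A hA
    simp only [hX]
    rw [htriple A hA, hA, inv_one, gauss_one hψ3]; ring
  have hXn : ∀ A : MulChar F ℂ, A ^ 3 ≠ 1 → 
      X A * star (X A) = (((Fintype.card F : ℝ) ^ 2 : ℝ) : ℂ) ^ 2 := by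
    intro A hA
    have a1 : A ≠ 1 := by rintro rfl; simp at hA
    have a2 : A * ρ ≠ 1 := by
      intro h; apply hA
      rw [eq_inv_of_mul_eq_one_left h, inv_pow, hρ3, inv_one]
    have a3 : A * ρ ^ 2 ≠ 1 := by
      intro h; apply hA
      rw [eq_inv_of_mul_eq_one_left h, inv_pow, ← pow_mul, mul_comm, pow_mul, hρ3, one_pow, inv_one]
    have b1 := gauss_mul_star hψ a1
    have b2 := gauss_mul_star hψ a2
    have b3 := gauss_mul_star hψ a3
    have b4 := gauss_mul_star hψ3 (inv_ne_one.mpr hA)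
    simp only [hX, star_mul']
    push_cast
    calc _ = (gaussSum A ψ * star (gaussSum A ψ)) * (gaussSum (A * ρ) ψ * star (gaussSum (A * ρ) ψ))
          * (gaussSum (A * ρ ^ 2) ψ * star (gaussSum (A * ρ ^ 2) ψ))
          * (gaussSum (A ^ 3)⁻¹ (ψ.mulShift (-3)) * star (gaussSum (A ^ 3)⁻¹ (ψ.mulShift (-3)))) := by
            ring
      _ = _ := by rw [b1, b2, b3, b4]; ring
  have hfilter : Finset.univ.filter (fun A : MulChar F ℂ => A ^ 3 = 1) = {1, ρ, ρ ^ 2} := by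
    ext A
    simp only [Finset.mem_filter, Finset.mem_univ, true_and, Finset.mem_insert, Finset.mem_singleton]
    constructor
    · exact hd_unique3 hρ hρ3
    · rintro (rfl | rfl | rfl)
      · simp
      · exact hρ3
      · rw [← pow_mul, mul_comm, pow_mul, hρ3, one_pow]
  have hcard3 : (Finset.univ.filter (fun A : MulChar F ℂ => A ^ 3 = 1)).card = 3 := by
    rw [hfilter, Finset.card_insert_of_notMem, Finset.card_insert_of_notMem, Finset.card_singleton]
    · simpa using hrr.symm
    · simp only [Finset.mem_insert, Finset.mem_singleton, not_or]
      exact ⟨hρ.symm, hr2.symm⟩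
  have hcardn : ((Finset.univ.filter (fun A : MulChar F ℂ => ¬ A ^ 3 = 1)).card : ℂ) =
      Fintype.card F - 4 := by
    have := Finset.card_filter_add_card_filter_not (s := Finset.univ) (fun A : MulChar F ℂ => A ^ 3 = 1)
    rw [hcard3, Finset.card_univ, card_mulChar_eq] at this
    have h1 : 0 < Fintype.card F := Fintype.card_pos
    have h2 : (Finset.univ.filter (fun A : MulChar F ℂ => ¬ A ^ 3 = 1)).card + 4 = Fintype.card F := by
      omega
    rw [← h2]; push_cast; ring
  have hE := e_sum hψ h3 hζ hρ hρ3
  rw [← Finset.sum_filter_add_sum_filter_not Finset.univ (fun A : MulChar F ℂ => A ^ 3 = 1),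
    Finset.sum_congr rfl (g := fun _ => (Fintype.card F : ℂ))
      (fun A hA => hXt A (Finset.mem_filter.mp hA).2), Finset.sum_const, hcard3, nsmul_eq_mul] at hE
  have key := eq_of_sum_norm _ X ((Fintype.card F : ℝ) ^ 2)
    (fun A hA => hXn A (Finset.mem_filter.mp hA).2)
    (by rw [hcardn]; push_cast at hE ⊢; simp only [hX]; linear_combination hE)
    χ (by simpa using hχ)
  simp only [hX] at key
  push_cast at key
  have hG : gaussSum (χ ^ 3) ψ * gaussSum (χ ^ 3)⁻¹ (ψ.mulShift (-3)) = (χ ^ 3) 3 * Fintype.card F := by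
    have := gaussSum_mulShift_eq (χ ^ 3)⁻¹ ψ (Units.mk0 (-3) h30)
    rw [inv_inv, Units.val_mk0] at this
    rw [this, mul_left_comm, gauss_mul_inv hψ hχ, ← mul_assoc, ← map_mul]
    norm_num
  have hq0 : (Fintype.card F : ℂ) ≠ 0 := card_ne_zeroC
  apply mul_left_cancel₀ hq0
  linear_combination gaussSum (χ ^ 3) ψ * key - gaussSum χ ψ * gaussSum (χ * ρ) ψ * gaussSum (χ * ρ ^ 2) ψ * hG

end HD


section MainAux
set_option linter.unusedSectionVars false
variable {F : Type} [Field F] [Fintype F]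

lemma exists_gauss (p : ℕ) [Fact p.Prime] [Algebra (ZMod p) F] :
    ∃ ψ : AddChar F ℂ, ψ.IsPrimitive ∧ ∀ χ : MulChar F ℂ, gaussChar p F χ = gaussSum χ ψ := by
  let ψ : AddChar F ℂ := (ZMod.stdAddChar (N := p)).compAddMonoidHom
    (Algebra.trace (ZMod p) F).toAddMonoidHom
  have hψ : ∀ x, ψ x = ZMod.stdAddChar (Algebra.trace (ZMod p) F x) := fun x => rfl
  refine ⟨ψ, AddChar.IsPrimitive.of_ne_one ?_, ?_⟩
  · intro h
    have : Module.Finite (ZMod p) F := Module.Finite.of_finite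
    obtain ⟨x, hx⟩ := Algebra.trace_surjective (ZMod p) F 1
    have h1 := hψ x
    rw [h, hx, AddChar.one_apply] at h1
    have h2 : (ZMod.stdAddChar (0 : ZMod p)) = ZMod.stdAddChar (1 : ZMod p) := by
      rw [← h1, AddChar.map_zero_eq_one]
    exact zero_ne_one (ZMod.injective_stdAddChar h2)
  · intro χ
    unfold gaussChar gaussSum
    refine Finset.sum_congr rfl fun x _ => ?_
    rw [hψ, ZMod.stdAddChar_apply, ZMod.toCircle_apply]

lemma jacobiS_eq (A B : MulChar F ℂ) : jacobiS F ![A, B] = jacobiSum A B := by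
  unfold jacobiS jacobiSum
  refine Finset.sum_bij' (fun v _ => v 0) (fun x _ => ![x, 1 - x]) ?_ ?_ ?_ ?_ ?_
  · simp
  · simp
  · intro v hv
    simp only [Finset.mem_filter, Finset.mem_univ, true_and, Fin.sum_univ_two] at hv
    ext i
    fin_cases i
    · rfl
    · simp; linear_combination -hv
  · simp
  · intro v hv
    simp only [Finset.mem_filter, Finset.mem_univ, true_and, Fin.sum_univ_two] at hv
    rw [Fin.prod_univ_two, ← hv]
    simp

lemma gBinom_eq {ψ : AddChar F ℂ} (hψ : ψ.IsPrimitive) {A : MulChar F ℂ} (hA : A ≠ 1)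
    (η : MulChar F ℂ) :
    gBinom F (A * η) η =
      η (-1) / Fintype.card F * (gaussSum (A * η) ψ * gaussSum η⁻¹ ψ / gaussSum A ψ) := by
  unfold gBinom
  rw [jacobiS_eq, jacobiSum_eq_gaussSum_mul_gaussSum_div_gaussSum card_ne_zeroC _ hψ,
    mul_inv_cancel_right]
  rwa [mul_inv_cancel_right]

lemma omega_bij [Fintype (MulChar F ℂ)] (ω : MulChar F ℂ) (hω : ∀ χ : MulChar F ℂ, ∃ j : ℕ, χ = ω ^ j) :
    Set.InjOn (fun j => ω ^ j) (Finset.range (Fintype.card F - 1)) ∧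
    (Finset.range (Fintype.card F - 1)).image (fun j => ω ^ j) = Finset.univ := by
  have hpow : ω ^ (Fintype.card F - 1) = 1 := by
    rw [← card_mulChar_eq]; exact pow_card_eq_one
  have h1 : 0 < Fintype.card F - 1 := by
    have := Fintype.one_lt_card (α := F); omega
  have himg : (Finset.range (Fintype.card F - 1)).image (fun j => ω ^ j) = Finset.univ := by
    ext χ
    simp only [Finset.mem_image, Finset.mem_range, Finset.mem_univ, iff_true]
    obtain ⟨j, hj⟩ := hω χ
    exact ⟨j % (Fintype.card F - 1), Nat.mod_lt _ h1, by rw [hj, ← pow_eq_pow_mod _ hpow]⟩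
  refine ⟨?_, himg⟩
  rw [← Finset.card_image_iff, himg, Finset.card_univ, card_mulChar_eq, Finset.card_range]

lemma omega_sum [Fintype (MulChar F ℂ)] (ω : MulChar F ℂ) (hω : ∀ χ : MulChar F ℂ, ∃ j : ℕ, χ = ω ^ j)
    (f : MulChar F ℂ → ℂ) :
    ∑ j ∈ Finset.range (Fintype.card F - 1), f (ω ^ j) = ∑ χ : MulChar F ℂ, f χ := by
  obtain ⟨h1, h2⟩ := omega_bij ω hω
  rw [← h2, Finset.sum_image h1]

/-- correction factor -/
noncomputable def corr (B : MulChar F ℂ) : ℂ := if B = 1 then 1 / (Fintype.card F : ℂ) else 1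

lemma gauss_corr {ψ : AddChar F ℂ} (hψ : ψ.IsPrimitive) (B : MulChar F ℂ) :
    gaussSum B ψ * gaussSum B⁻¹ ψ = B (-1) * Fintype.card F * corr B := by
  unfold corr
  split_ifs with h
  · subst h
    rw [inv_one, gauss_one hψ, MulChar.one_apply isUnit_one.neg]
    have : (Fintype.card F : ℂ) ≠ 0 := card_ne_zeroC
    field_simp
  · rw [gauss_mul_inv hψ h, mul_one]

lemma term_eq {ψ : AddChar F ℂ} (hψ : ψ.IsPrimitive) (h2 : (2 : F) ≠ 0) (h3 : (3 : F) ≠ 0) {ζ : F}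
    (hζ : ζ ^ 2 + ζ + 1 = 0) {a : MulChar F ℂ} (ha6 : a ^ 6 = 1) (ha2 : a ^ 2 ≠ 1) (ha3 : a ^ 3 ≠ 1)
    {lam : F} (hlam : lam ≠ 0) (χ : MulChar F ℂ) :
    (Fintype.card F : ℂ) ^ 4 * (gBinom F (a * χ⁻¹) χ⁻¹ * (gBinom F (a ^ 3 * χ⁻¹) χ⁻¹ *
      gBinom F (a⁻¹ * χ⁻¹) χ⁻¹) * χ⁻¹ (lam ^ 6)⁻¹) =
    gaussSum χ ψ ^ 4 * gaussSum (χ * a ^ 2) ψ * gaussSum (χ * a ^ 4) ψ / gaussSum (χ ^ 6) ψ *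
      (χ ^ 6) (6 * lam) * (corr (χ * a) * corr (χ * a ^ 3) * corr (χ * a ^ 5)) := by
  have hq0 : (Fintype.card F : ℂ) ≠ 0 := card_ne_zeroC
  set q : ℂ := (Fintype.card F : ℂ) with hq
  have ha1 : a ≠ 1 := by rintro rfl; simp at ha2
  have hai : a⁻¹ = a ^ 5 := by
    rw [inv_eq_iff_mul_eq_one, ← pow_succ', ha6]
  have ha3i : (a ^ 3)⁻¹ = a ^ 3 := by
    rw [inv_eq_iff_mul_eq_one, ← pow_add, ha6]
  rw [gBinom_eq hψ ha1, gBinom_eq hψ ha3, gBinom_eq hψ (inv_ne_one.mpr ha1)]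
  have hφ2 : (a ^ 3) ^ 2 = 1 := by rw [← pow_mul, ha6]
  have hρ3 : (a ^ 2) ^ 3 = 1 := by rw [← pow_mul, ha6]
  -- Hasse-Davenport
  have e1 := hd3 hψ h3 hζ ha2 hρ3 χ
  have e2 := hd3 hψ h3 hζ ha2 hρ3 (χ * a)
  have e3 := hd2 hψ h2 ha3 hφ2 (χ ^ 3)
  have r1 : (a ^ 2) ^ 2 = a ^ 4 := by rw [← pow_mul]
  have r2 : χ * a * a ^ 2 = χ * a ^ 3 := by rw [mul_assoc, ← pow_succ']
  have r3 : χ * a * a ^ 4 = χ * a ^ 5 := by rw [mul_assoc, ← pow_succ']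
  have r4 : (χ ^ 3) ^ 2 = χ ^ 6 := by rw [← pow_mul]
  have r5 : (χ * a) ^ 3 = χ ^ 3 * a ^ 3 := mul_pow _ _ _
  rw [r1] at e1
  rw [r1, r2, r3, r5, MulChar.mul_apply] at e2
  rw [r4] at e3
  -- correction
  have c1 := gauss_corr hψ (χ * a)
  have c2 := gauss_corr hψ (χ * a ^ 3)
  have c3 := gauss_corr hψ (χ * a ^ 5)
  have s1 : (χ * a)⁻¹ = a⁻¹ * χ⁻¹ := by rw [mul_inv, mul_comm]
  have s2 : (χ * a ^ 3)⁻¹ = a ^ 3 * χ⁻¹ := by rw [mul_inv, mul_comm, ha3i]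
  have s3 : (χ * a ^ 5)⁻¹ = a * χ⁻¹ := by rw [mul_inv, mul_comm, ← hai, inv_inv]
  rw [s1] at c1
  rw [s2] at c2
  rw [s3] at c3
  have d1 := gauss_mul_inv hψ ha1
  have d2 := gauss_mul_inv hψ ha3
  rw [ha3i] at d2
  -- values
  have v1 : χ⁻¹ (-1) = χ (-1) := by rw [MulChar.inv_apply', inv_neg_one]
  have v2 : χ⁻¹ (lam ^ 6)⁻¹ = χ lam ^ 6 := by rw [MulChar.inv_apply', inv_inv, map_pow]
  have v3 : (χ ^ 6) (6 * lam) = χ 2 ^ 6 * χ 3 ^ 6 * χ lam ^ 6 := by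
    rw [MulChar.pow_apply' _ (by norm_num), show (6 : F) = 2 * 3 by norm_num, map_mul, map_mul]; ring
  have v4 : (χ ^ 3) 4 = χ 2 ^ 6 := by
    rw [MulChar.pow_apply' _ (by norm_num), show (4 : F) = 2 * 2 by norm_num, map_mul]; ring
  have v5 : (χ ^ 3) 3 = χ 3 ^ 3 := MulChar.pow_apply' _ (by norm_num) _
  have hsq := char_neg_one_sq χ
  have hasq := char_neg_one_sq a
  have v6 : (a ^ 3) (-1) = a (-1) := by
    rw [MulChar.pow_apply' _ (by norm_num)]; linear_combination a (-1) * hasq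
  have v7 : (a ^ 5) (-1) = a (-1) := by
    rw [MulChar.pow_apply' _ (by norm_num)]
    linear_combination a (-1) * (a (-1) * a (-1) + 1) * hasq
  have v8 : (a ^ 3) 3 = a (-1) := by
    have w0 : (2 * ζ + 1) ^ 2 = -3 := by linear_combination 4 * hζ
    have w1 : (2 * ζ + 1) ≠ 0 := by
      intro h; rw [h] at w0; apply h3; linear_combination w0
    have w2 : (a ^ 3) (-3) = 1 := by
      rw [← w0, map_pow, ← MulChar.pow_apply' _ two_ne_zero, hφ2, MulChar.one_apply (IsUnit.mk0 _ w1)]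
    rw [show (3 : F) = (-1) * (-3) by norm_num, map_mul, w2, v6, mul_one]
  rw [v1, v2, v3]
  rw [v4] at e3
  rw [v5] at e1
  rw [v5, v8] at e2
  rw [MulChar.mul_apply] at c1 c2 c3
  rw [v6] at c2 d2
  rw [v7] at c3
  have n2 : χ 2 ≠ 0 := by
    rw [MulChar.apply_ne_zero_iff]; exact IsUnit.mk0 _ h2
  have n3 : χ 3 ≠ 0 := by
    rw [MulChar.apply_ne_zero_iff]; exact IsUnit.mk0 _ h3
  have n1 : a (-1) ≠ 0 := fun h => by simp [h] at hasq
  rw [inv_inv]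
  have g0 := gauss_ne_zero hψ (χ ^ 6)
  have g1 := gauss_ne_zero hψ a
  have g2 := gauss_ne_zero hψ a⁻¹
  have g3 := gauss_ne_zero hψ (a ^ 3)
  have g4 := gauss_ne_zero hψ (χ ^ 3)
  have g5 := gauss_ne_zero hψ (χ ^ 3 * a ^ 3)
  have g6 := gauss_ne_zero hψ (χ * a)
  have g7 := gauss_ne_zero hψ (χ * a ^ 3)
  have g8 := gauss_ne_zero hψ (χ * a ^ 5)
  have g9 := gauss_ne_zero hψ χ
  simp only [← hq] at *
  generalize gaussSum (χ ^ 6) ψ = G6 at *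
  generalize gaussSum (χ ^ 3) ψ = G3 at *
  generalize gaussSum (χ ^ 3 * a ^ 3) ψ = G33 at *
  generalize gaussSum (χ * a) ψ = X1 at *
  generalize gaussSum (χ * a ^ 3) ψ = X3 at *
  generalize gaussSum (χ * a ^ 5) ψ = X5 at *
  generalize gaussSum (χ * a ^ 2) ψ = X2 at *
  generalize gaussSum (χ * a ^ 4) ψ = X4 at *
  generalize gaussSum χ ψ = X0 at *
  generalize gaussSum (a * χ⁻¹) ψ = Y1 at *
  generalize gaussSum (a ^ 3 * χ⁻¹) ψ = Y3 at *
  generalize gaussSum (a⁻¹ * χ⁻¹) ψ = Y5 at *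
  generalize gaussSum a ψ = A1 at *
  generalize gaussSum a⁻¹ ψ = A5 at *
  generalize gaussSum (a ^ 3) ψ = A3 at *
  generalize corr (χ * a) = k1 at *
  generalize corr (χ * a ^ 3) = k3 at *
  generalize corr (χ * a ^ 5) = k5 at *
  generalize χ lam ^ 6 = L at *
  generalize χ (-1) = m at *
  generalize a (-1) = n at *
  generalize χ 2 ^ 6 = u2 at *
  generalize hu3 : χ 3 = u3 at *
  clear_value q
  clear hq hu3
  -- product of three corrections
  have P1 : (X1 * X3 * X5) * (Y1 * Y3 * Y5) = m * n * q ^ 3 * (k1 * k3 * k5) := by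
    have : (X1 * X3 * X5) * (Y1 * Y3 * Y5) = (X1 * Y5) * (X3 * Y3) * (X5 * Y1) := by ring
    rw [this, c1, c2, c3]
    linear_combination (m * n * q ^ 3 * (k1 * k3 * k5)) * (n * n * hsq + hasq)
  have hX : X1 * X3 * X5 ≠ 0 := mul_ne_zero (mul_ne_zero g6 g7) g8
  have P2 : X0 * X2 * X4 * (u2 * u3 ^ 6) * (X1 * X3 * X5) = n * q ^ 2 * A3 * G6 := by
    have hne : u3 ^ 3 * n * G3 ≠ 0 := mul_ne_zero (mul_ne_zero (pow_ne_zero _ n3) n1) g4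
    apply mul_right_cancel₀ hne
    calc _ = (X0 * X2 * X4 * u3 ^ 3) * (X1 * X3 * X5 * (u3 ^ 3 * n)) * u2 * u3 ^ 3 * G3 := by ring
      _ = q * G3 * (q * G33) * u2 * u3 ^ 3 * G3 := by rw [e1, e2]
      _ = q ^ 2 * G3 * u3 ^ 3 * (G3 * G33 * u2) := by ring
      _ = q ^ 2 * G3 * u3 ^ 3 * (G6 * A3) := by rw [e3]
      _ = _ := by linear_combination -(q ^ 2 * G3 * u3 ^ 3 * (G6 * A3)) * hasq
  have P3 : A1 * A3 * A5 * A3 = q ^ 2 := by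
    calc _ = (A1 * A5) * (A3 * A3) := by ring
      _ = n * q * (n * q) := by rw [d1, d2]
      _ = _ := by linear_combination q ^ 2 * hasq
  have hY : Y1 * Y3 * Y5 = m * n * q ^ 3 * (k1 * k3 * k5) / (X1 * X3 * X5) := by
    rw [eq_div_iff hX]; linear_combination P1
  have hZ : X0 * X2 * X4 * (u2 * u3 ^ 6) = n * q ^ 2 * A3 * G6 / (X1 * X3 * X5) := by
    rw [eq_div_iff hX]; exact P2
  have hm3 : m ^ 3 * m = 1 := by linear_combination (m * m + 1) * hsq
  calc _ = q * m ^ 3 * X0 ^ 3 * (Y1 * Y3 * Y5) / (A1 * A3 * A5) * L := by field_simp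
    _ = X0 ^ 3 * (X0 * X2 * X4 * (u2 * u3 ^ 6)) / G6 * L * (k1 * k3 * k5) := by
      rw [hY, hZ]
      field_simp
      linear_combination (k1 * k3 * k5 * L * q ^ 2) * hm3 - (k1 * k3 * k5 * L) * P3
    _ = _ := by ring

end MainAux

/-- The contribution of the class of `w = (0,0,0,0,2,4)` in Koblitz's formula. -/
theorem class_000024 (p e q t : ℕ) [Fact p.Prime] (F : Type) [Field F] [Fintype F]
    [Algebra (ZMod p) F]
    (he : 0 < e) (hq : q = Fintype.card F) (hqe : q = p ^ e) (hmod : q % 6 = 1)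
    (ht : t = (q - 1) / 6)
    (ω : MulChar F ℂ) (hω : ∀ χ : MulChar F ℂ, ∃ j : ℕ, χ = ω ^ j)
    (ω₆ ω₃ ω₂ : MulChar F ℂ)
    (hω₆ : ω₆ = ω ^ t) (hω₃ : ω₃ = ω ^ (2 * t)) (hω₂ : ω₂ = ω ^ (3 * t))
    (lam : F) (hlam : lam ≠ 0) (hlam6 : lam ^ 6 ≠ 1) :
    (∑ k ∈ Finset.range 6, NqW p F ω 6 (fun i => (![0,0,0,0,2,4] : Fin 6 → ZMod 6) i + (k : ZMod 6))) +
      SW p F ω 6 (fun _ => 1) (![0,0,0,0,2,4] : Fin 6 → ZMod 6) lam =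
      (q : ℂ) ^ 3 * greeneF F ω ![ω₆, ω₂, ω₆⁻¹] ![1, 1] (lam ^ 6)⁻¹ := by
  subst hq
  obtain ⟨ψ, hψ, hg⟩ := exists_gauss (F := F) p
  have : Fintype (MulChar F ℂ) := Fintype.ofFinite _
  have hlt : 1 < Fintype.card F := Fintype.one_lt_card
  have hcard : Fintype.card F = 6 * t + 1 := by omega
  have htpos : 0 < t := by omega
  have hcast : (6 * t + 1 : F) = 0 := by
    have := FiniteField.cast_card_eq_zero F
    rw [hcard] at this
    exact_mod_cast this
  have h2 : (2 : F) ≠ 0 := by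
    intro h
    apply one_ne_zero (α := F)
    linear_combination hcast - 3 * (t : F) * h
  have h3 : (3 : F) ≠ 0 := by
    intro h
    apply one_ne_zero (α := F)
    linear_combination hcast - 2 * (t : F) * h
  have h6 : (6 : F) ≠ 0 := by
    rw [show (6 : F) = 2 * 3 by norm_num]; exact mul_ne_zero h2 h3
  obtain ⟨ζ, hζ⟩ : ∃ ζ : F, ζ ^ 2 + ζ + 1 = 0 := by
    have : Fact (Nat.Prime 3) := ⟨Nat.prime_three⟩
    obtain ⟨u, hu⟩ := exists_prime_orderOf_dvd_card (G := Fˣ) 3 (by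
      rw [Fintype.card_units]; omega)
    have hu3 : (u : F) ^ 3 = 1 := by
      have := pow_orderOf_eq_one u
      rw [hu] at this
      rw [← Units.val_pow_eq_pow_val, this, Units.val_one]
    have hu1 : (u : F) ≠ 1 := by
      intro h
      have : u = 1 := Units.ext h
      rw [this, orderOf_one] at hu
      omega
    refine ⟨u, mul_left_cancel₀ (sub_ne_zero.mpr hu1) ?_⟩
    linear_combination hu3
  have hdiv : (Fintype.card F - 1) / 6 = t := ht.symm
  obtain ⟨hinj, -⟩ := omega_bij ω hω
  obtain ⟨a, ha⟩ : ∃ a, a = ω ^ t := ⟨_, rfl⟩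
  have hapow : ∀ k, ω ^ (k * t) = a ^ k := fun k => by rw [ha, ← pow_mul, mul_comm]
  have hane : ∀ k, 0 < k → k < 6 → a ^ k ≠ 1 := by
    intro k hk hk6 h
    rw [← hapow, ← pow_zero ω] at h
    have hkt : 0 < k * t := Nat.mul_pos hk htpos
    have hkt' : k * t < 6 * t := Nat.mul_lt_mul_of_pos_right hk6 htpos
    have := hinj (by simp only [Finset.coe_range, Set.mem_Iio]; omega)
      (by simp only [Finset.coe_range, Set.mem_Iio]; omega) h
    omega
  have ha6 : a ^ 6 = 1 := by
    rw [← hapow, show 6 * t = Fintype.card F - 1 by omega, ← card_mulChar_eq]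
    exact pow_card_eq_one
  have ha2 := hane 2 (by norm_num) (by norm_num)
  have ha3 := hane 3 (by norm_num) (by norm_num)
  have ha4 := hane 4 (by norm_num) (by norm_num)
  have hq0 : (Fintype.card F : ℂ) ≠ 0 := card_ne_zeroC
  have hq1 : (Fintype.card F : ℂ) - 1 ≠ 0 := by
    rw [hcard]; push_cast
    have : (t : ℂ) ≠ 0 := by exact_mod_cast htpos.ne'
    simpa using this
  -- the basic summand
  obtain ⟨T, hT⟩ : ∃ T : MulChar F ℂ → ℂ, ∀ χ, T χ = gaussSum χ ψ ^ 4 * gaussSum (χ * a ^ 2) ψ *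
      gaussSum (χ * a ^ 4) ψ / gaussSum (χ ^ 6) ψ * (χ ^ 6) (6 * lam) := ⟨_, fun _ => rfl⟩
  have hS : SW p F ω 6 (fun _ => 1) (![0,0,0,0,2,4] : Fin 6 → ZMod 6) lam =
      ((Fintype.card F : ℂ) - 1)⁻¹ * ∑ χ : MulChar F ℂ, T χ := by
    unfold SW
    rw [← omega_sum ω hω]
    congr 1
    refine Finset.sum_congr rfl fun j _ => ?_
    have z2 : (2 : ZMod 6).val = 2 := rfl
    have z4 : (4 : ZMod 6).val = 4 := rfl
    have z0 : (0 : ZMod 6).val = 0 := rfl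
    have y0 : ω ^ (0 * t + 1 * j) = ω ^ j := by simp
    have y2 : ω ^ (2 * t + 1 * j) = ω ^ j * a ^ 2 := by
      rw [pow_add, hapow, one_mul, mul_comm]
    have y4 : ω ^ (4 * t + 1 * j) = ω ^ j * a ^ 4 := by
      rw [pow_add, hapow, one_mul, mul_comm]
    have y6 : ω ^ (6 * j) = (ω ^ j) ^ 6 := by rw [← pow_mul, mul_comm]
    have c6 : ((6 : ℕ) : F) = 6 := by norm_num
    have e0 : (![0,0,0,0,2,4] : Fin 6 → ZMod 6) 0 = 0 := rfl
    have e1 : (![0,0,0,0,2,4] : Fin 6 → ZMod 6) 1 = 0 := rfl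
    have e2 : (![0,0,0,0,2,4] : Fin 6 → ZMod 6) 2 = 0 := rfl
    have e3 : (![0,0,0,0,2,4] : Fin 6 → ZMod 6) 3 = 0 := rfl
    have e4 : (![0,0,0,0,2,4] : Fin 6 → ZMod 6) 4 = 2 := rfl
    have e5 : (![0,0,0,0,2,4] : Fin 6 → ZMod 6) 5 = 4 := rfl
    rw [Fin.prod_univ_six, e0, e1, e2, e3, e4, e5, z0, z2, z4, hdiv, y0, y2, y4, y6, c6, hT]
    simp only [hg]
    ring
  have hG : (Fintype.card F : ℂ) ^ 3 * greeneF F ω ![ω₆, ω₂, ω₆⁻¹] ![1, 1] (lam ^ 6)⁻¹ =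
      ((Fintype.card F : ℂ) - 1)⁻¹ * ∑ χ : MulChar F ℂ,
        T χ * (corr (χ * a) * corr (χ * a ^ 3) * corr (χ * a ^ 5)) := by
    have hterm : ∀ χ : MulChar F ℂ, T χ * (corr (χ * a) * corr (χ * a ^ 3) * corr (χ * a ^ 5)) =
      (Fintype.card F : ℂ) ^ 4 * (gBinom F (a * χ⁻¹) χ⁻¹ * (gBinom F (a ^ 3 * χ⁻¹) χ⁻¹ *
        gBinom F (a⁻¹ * χ⁻¹) χ⁻¹) * χ⁻¹ (lam ^ 6)⁻¹) := fun χ => by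
      rw [term_eq hψ h2 h3 hζ ha6 ha2 ha3 hlam, hT]
    have hsum : ∑ j ∈ Finset.range (Fintype.card F - 1),
        gBinom F ((![ω₆, ω₂, ω₆⁻¹] : Fin 3 → MulChar F ℂ) 0 * ω ^ j) (ω ^ j) *
        (∏ i : Fin 2, gBinom F ((![ω₆, ω₂, ω₆⁻¹] : Fin 3 → MulChar F ℂ) i.succ * ω ^ j)
          ((![1, 1] : Fin 2 → MulChar F ℂ) i * ω ^ j)) * (ω ^ j) (lam ^ 6)⁻¹ =
        ∑ χ : MulChar F ℂ, (gBinom F (a * χ⁻¹) χ⁻¹ * (gBinom F (a ^ 3 * χ⁻¹) χ⁻¹ *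
        gBinom F (a⁻¹ * χ⁻¹) χ⁻¹) * χ⁻¹ (lam ^ 6)⁻¹) := by
      refine Eq.trans ?_ (Equiv.sum_comp (Equiv.inv (MulChar F ℂ)) (fun χ => gBinom F (a * χ) χ *
        (gBinom F (a ^ 3 * χ) χ * gBinom F (a⁻¹ * χ) χ) * χ (lam ^ 6)⁻¹)).symm
      rw [← omega_sum ω hω]
      refine Finset.sum_congr rfl fun j _ => ?_
      have f0 : (![ω₆, ω₂, ω₆⁻¹] : Fin 3 → MulChar F ℂ) 0 = a := by rw [ha, ← hω₆]; rfl
      have f1 : (![ω₆, ω₂, ω₆⁻¹] : Fin 3 → MulChar F ℂ) (Fin.succ 0) = a ^ 3 := by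
        rw [← hapow, ← hω₂]; rfl
      have f2 : (![ω₆, ω₂, ω₆⁻¹] : Fin 3 → MulChar F ℂ) (Fin.succ 1) = a⁻¹ := by
        rw [ha, ← hω₆]; rfl
      have b0 : (![1, 1] : Fin 2 → MulChar F ℂ) 0 = 1 := rfl
      have b1 : (![1, 1] : Fin 2 → MulChar F ℂ) 1 = 1 := rfl
      rw [Fin.prod_univ_two, f0, f1, f2, b0, b1, one_mul]
    unfold greeneF
    rw [hsum]
    simp only [hterm]
    rw [← Finset.mul_sum]
    ring
  have hN0 : ∀ w : Fin 6 → ZMod 6, (¬ ∀ i, w i = 0) → (¬ ∀ i, w i ≠ 0) → NqW p F ω 6 w = 0 := by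
    intro w hw1 hw2
    unfold NqW
    rw [if_neg hw1, if_neg hw2]
  have hN1 : ∀ w : Fin 6 → ZMod 6, (¬ ∀ i, w i = 0) → (∀ i, w i ≠ 0) → NqW p F ω 6 w =
      1 / (Fintype.card F : ℂ) * ∏ i, gaussSum (a ^ (w i).val) ψ := by
    intro w hw1 hw2
    unfold NqW
    rw [if_neg hw1, if_pos hw2, hdiv]
    simp only [hg, hapow]
  have hN : (∑ k ∈ Finset.range 6, NqW p F ω 6
      (fun i => (![0,0,0,0,2,4] : Fin 6 → ZMod 6) i + (k : ZMod 6))) =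
      1 / (Fintype.card F : ℂ) * (gaussSum a ψ ^ 4 * gaussSum (a ^ 3) ψ * gaussSum (a ^ 5) ψ +
        gaussSum (a ^ 3) ψ ^ 4 * gaussSum (a ^ 5) ψ * gaussSum a ψ +
        gaussSum (a ^ 5) ψ ^ 4 * gaussSum a ψ * gaussSum (a ^ 3) ψ) := by
    have k0 := hN0 (fun i => (![0,0,0,0,2,4] : Fin 6 → ZMod 6) i + ((0 : ℕ) : ZMod 6))
      (by decide) (by decide)
    have k2 := hN0 (fun i => (![0,0,0,0,2,4] : Fin 6 → ZMod 6) i + ((2 : ℕ) : ZMod 6))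
      (by decide) (by decide)
    have k4 := hN0 (fun i => (![0,0,0,0,2,4] : Fin 6 → ZMod 6) i + ((4 : ℕ) : ZMod 6))
      (by decide) (by decide)
    have k1 := hN1 (fun i => (![0,0,0,0,2,4] : Fin 6 → ZMod 6) i + ((1 : ℕ) : ZMod 6))
      (by decide) (by decide)
    have k3 := hN1 (fun i => (![0,0,0,0,2,4] : Fin 6 → ZMod 6) i + ((3 : ℕ) : ZMod 6))
      (by decide) (by decide)
    have k5 := hN1 (fun i => (![0,0,0,0,2,4] : Fin 6 → ZMod 6) i + ((5 : ℕ) : ZMod 6))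
      (by decide) (by decide)
    have v1 : ∀ i, ((![0,0,0,0,2,4] : Fin 6 → ZMod 6) i + ((1 : ℕ) : ZMod 6)).val =
      (![1,1,1,1,3,5] : Fin 6 → ℕ) i := by decide
    have v3 : ∀ i, ((![0,0,0,0,2,4] : Fin 6 → ZMod 6) i + ((3 : ℕ) : ZMod 6)).val =
      (![3,3,3,3,5,1] : Fin 6 → ℕ) i := by decide
    have v5 : ∀ i, ((![0,0,0,0,2,4] : Fin 6 → ZMod 6) i + ((5 : ℕ) : ZMod 6)).val =
      (![5,5,5,5,1,3] : Fin 6 → ℕ) i := by decide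
    simp only [v1] at k1
    simp only [v3] at k3
    simp only [v5] at k5
    have x1 : ∏ i, gaussSum (a ^ (![1,1,1,1,3,5] : Fin 6 → ℕ) i) ψ =
        gaussSum a ψ ^ 4 * gaussSum (a ^ 3) ψ * gaussSum (a ^ 5) ψ := by
      rw [Fin.prod_univ_six]
      change gaussSum (a ^ 1) ψ * gaussSum (a ^ 1) ψ * gaussSum (a ^ 1) ψ * gaussSum (a ^ 1) ψ *
        gaussSum (a ^ 3) ψ * gaussSum (a ^ 5) ψ = _
      rw [pow_one]; ring
    have x3 : ∏ i, gaussSum (a ^ (![3,3,3,3,5,1] : Fin 6 → ℕ) i) ψ =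
        gaussSum (a ^ 3) ψ ^ 4 * gaussSum (a ^ 5) ψ * gaussSum a ψ := by
      rw [Fin.prod_univ_six]
      change gaussSum (a ^ 3) ψ * gaussSum (a ^ 3) ψ * gaussSum (a ^ 3) ψ * gaussSum (a ^ 3) ψ *
        gaussSum (a ^ 5) ψ * gaussSum (a ^ 1) ψ = _
      rw [pow_one]; ring
    have x5 : ∏ i, gaussSum (a ^ (![5,5,5,5,1,3] : Fin 6 → ℕ) i) ψ =
        gaussSum (a ^ 5) ψ ^ 4 * gaussSum a ψ * gaussSum (a ^ 3) ψ := by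
      rw [Fin.prod_univ_six]
      change gaussSum (a ^ 5) ψ * gaussSum (a ^ 5) ψ * gaussSum (a ^ 5) ψ * gaussSum (a ^ 5) ψ *
        gaussSum (a ^ 1) ψ * gaussSum (a ^ 3) ψ = _
      rw [pow_one]; ring
    simp only [Finset.sum_range_succ, Finset.sum_range_zero]
    rw [k0, k1, k2, k3, k4, k5, x1, x3, x5]
    ring
  -- values of T
  have hone : (1 : MulChar F ℂ) (6 * lam) = 1 :=
    MulChar.one_apply (IsUnit.mk0 _ (mul_ne_zero h6 hlam))
  have hT1 : T a = -(gaussSum a ψ ^ 4 * gaussSum (a ^ 3) ψ * gaussSum (a ^ 5) ψ) := by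
    rw [hT, ha6, hone, gauss_one hψ, ← pow_succ', ← pow_succ']
    ring
  have hT3 : T (a ^ 3) = -(gaussSum (a ^ 3) ψ ^ 4 * gaussSum (a ^ 5) ψ * gaussSum a ψ) := by
    rw [hT, ← pow_mul, show a ^ (3 * 6) = (a ^ 6) ^ 3 by rw [← pow_mul], ← pow_add, ← pow_add,
      show a ^ (3 + 4) = a ^ 6 * a by rw [← pow_succ], ha6, one_pow, one_mul, hone, gauss_one hψ]
    ring
  have hT5 : T (a ^ 5) = -(gaussSum (a ^ 5) ψ ^ 4 * gaussSum a ψ * gaussSum (a ^ 3) ψ) := by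
    rw [hT, ← pow_mul, show a ^ (5 * 6) = (a ^ 6) ^ 5 by rw [← pow_mul], ← pow_add, ← pow_add,
      show a ^ (5 + 2) = a ^ 6 * a by rw [← pow_succ],
      show a ^ (5 + 4) = a ^ 6 * a ^ 3 by rw [← pow_add], ha6, one_pow, one_mul, one_mul, hone,
      gauss_one hψ]
    ring
  have i1 : ∀ χ : MulChar F ℂ, χ * a = 1 ↔ χ = a ^ 5 := fun χ => by
    rw [← mul_left_inj a (b := χ), ← pow_succ, ha6]
  have i3 : ∀ χ : MulChar F ℂ, χ * a ^ 3 = 1 ↔ χ = a ^ 3 := fun χ => by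
    rw [← mul_left_inj (a ^ 3) (b := χ), ← pow_add, ha6]
  have i5 : ∀ χ : MulChar F ℂ, χ * a ^ 5 = 1 ↔ χ = a := fun χ => by
    rw [← mul_left_inj (a ^ 5) (b := χ), ← pow_succ', ha6]
  have n13 : a ≠ a ^ 3 := fun h => ha2 (mul_left_cancel (a := a) (by
    rw [← pow_succ', mul_one]; exact h.symm))
  have n15 : a ≠ a ^ 5 := fun h => ha4 (mul_left_cancel (a := a) (by
    rw [← pow_succ', mul_one]; exact h.symm))
  have n35 : a ^ 3 ≠ a ^ 5 := fun h => ha2 (mul_left_cancel (a := a ^ 3) (by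
    rw [← pow_add, mul_one]; exact h.symm))
  have hcorr : ∀ χ : MulChar F ℂ,
      T χ * (corr (χ * a) * corr (χ * a ^ 3) * corr (χ * a ^ 5)) = T χ -
      (1 - 1 / (Fintype.card F : ℂ)) * ((if χ = a then T χ else 0) + (if χ = a ^ 3 then T χ else 0) +
        (if χ = a ^ 5 then T χ else 0)) := by
    intro χ
    unfold corr
    simp only [i1, i3, i5]
    by_cases c1 : χ = a
    · subst c1
      simp only [if_neg n13, if_neg n15, if_true]; ring
    · by_cases c3 : χ = a ^ 3
      · rw [if_neg c1, if_neg c1, if_pos c3, if_pos c3, if_neg (c3 ▸ n35), if_neg (c3 ▸ n35)]; ring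
      · by_cases c5 : χ = a ^ 5
        · rw [if_neg c1, if_neg c1, if_neg c3, if_neg c3, if_pos c5, if_pos c5]; ring
        · rw [if_neg c1, if_neg c1, if_neg c3, if_neg c3, if_neg c5, if_neg c5]; ring
  have hfin : ∑ χ : MulChar F ℂ, T χ * (corr (χ * a) * corr (χ * a ^ 3) * corr (χ * a ^ 5)) =
      ∑ χ : MulChar F ℂ, T χ - (1 - 1 / (Fintype.card F : ℂ)) * (T a + T (a ^ 3) + T (a ^ 5)) := by
    simp only [hcorr]
    rw [Finset.sum_sub_distrib, ← Finset.mul_sum, Finset.sum_add_distrib, Finset.sum_add_distrib,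
      Finset.sum_ite_eq', Finset.sum_ite_eq', Finset.sum_ite_eq', if_pos (Finset.mem_univ _),
      if_pos (Finset.mem_univ _), if_pos (Finset.mem_univ _)]
  rw [hG, hS, hN, hfin, hT1, hT3, hT5]
  field_simp
  ring
end
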